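/- Let (f,g,ρ) be a warped Berger solution of Ricci flow on S^1×S^3 defined on [0,T) satisfying Assumption B. Then there exists a uniform constant C < ∞ such that the mixed sectional curvatures satisfy |κ_{01}(ξ,t) − κ_{02}(ξ,t)| ≤ C/M̌(t) for all (ξ,t) ∈ S^1×[0,T); consequently (T−t)|κ_{01} − κ_{02}| ≤ C·√(T−t) on S^1×[0,T). -/

import Mathlib

open Real Set Filter Topology

noncomputable section

/-- Partial derivative in the first (spatial, `ξ`) variable. -/
def pd1 (φ : ℝ → ℝ → ℝ) (ξ t : ℝ) : ℝ := deriv (fun x => φ x t) ξ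

/-- Partial derivative in the second (time) variable: `φ_t`. -/
def pdt (φ : ℝ → ℝ → ℝ) (ξ t : ℝ) : ℝ := deriv (fun τ => φ ξ τ) t

/-- Derivative with respect to arclength `s` (where `ds = ρ dξ`): `φ_s := ρ⁻¹ ∂_ξ φ`. -/
def Ds (ρ φ : ℝ → ℝ → ℝ) (ξ t : ℝ) : ℝ := pd1 φ ξ t / ρ ξ t

/-- Sectional curvature `κ₁₂ = κ₃₁ = f²/g⁴ − f_s g_s/(f g)`. -/
def k12 (ρ f g : ℝ → ℝ → ℝ) (ξ t : ℝ) : ℝ :=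
  (f ξ t) ^ 2 / (g ξ t) ^ 4 - Ds ρ f ξ t * Ds ρ g ξ t / (f ξ t * g ξ t)

/-- Sectional curvature `κ₃₁ = κ₁₂`. -/
def k31 (ρ f g : ℝ → ℝ → ℝ) (ξ t : ℝ) : ℝ :=
  (f ξ t) ^ 2 / (g ξ t) ^ 4 - Ds ρ f ξ t * Ds ρ g ξ t / (f ξ t * g ξ t)

/-- Sectional curvature `κ₂₃ = (4g² − 3f²)/g⁴ − g_s²/g²`. -/
def k23 (ρ f g : ℝ → ℝ → ℝ) (ξ t : ℝ) : ℝ :=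
  (4 * (g ξ t) ^ 2 - 3 * (f ξ t) ^ 2) / (g ξ t) ^ 4 - (Ds ρ g ξ t) ^ 2 / (g ξ t) ^ 2

/-- Sectional curvature `κ₀₁ = −f_ss/f`. -/
def k01 (ρ f : ℝ → ℝ → ℝ) (ξ t : ℝ) : ℝ := -(Ds ρ (Ds ρ f) ξ t) / f ξ t

/-- Sectional curvature `κ₀₂ = κ₀₃ = −g_ss/g`. -/
def k02 (ρ g : ℝ → ℝ → ℝ) (ξ t : ℝ) : ℝ := -(Ds ρ (Ds ρ g) ξ t) / g ξ t

/-- Scalar curvature `R = κ₀₁ + 2κ₀₂ + 2κ₁₂ + κ₂₃`. -/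
def scalR (ρ f g : ℝ → ℝ → ℝ) (ξ t : ℝ) : ℝ :=
  k01 ρ f ξ t + 2 * k02 ρ g ξ t + 2 * k12 ρ f g ξ t + k23 ρ f g ξ t

/-- `M(ξ,t) := min {f(ξ,t), g(ξ,t)}`. -/
def M (f g : ℝ → ℝ → ℝ) (ξ t : ℝ) : ℝ := min (f ξ t) (g ξ t)

/-- `M̌(t) := min_{ξ ∈ S¹} M(ξ,t)`. -/
def Mcheck (f g : ℝ → ℝ → ℝ) (t : ℝ) : ℝ := ⨅ ξ : ℝ, M f g ξ t

/-- A warped Berger solution of Ricci flow on `S¹ × S³` with (finite) existence time `T`: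
smooth positive `2π`-periodic-in-`ξ` functions `f, g, ρ` on `S¹ × [0,T)` satisfying
  `f_t = f_ss + 2 (g_s/g) f_s − 2 f³/g⁴`,
  `g_t = g_ss + (f_s/f + g_s/g) g_s + 2 (f² − 2g²)/g³`,
  `(log ρ)_t = f_ss/f + 2 g_ss/g`. -/
structure WarpedBerger (T : ℝ) (f g ρ : ℝ → ℝ → ℝ) : Prop where
  T_pos : 0 < T
  f_pos : ∀ ξ t : ℝ, 0 ≤ t → t < T → 0 < f ξ t
  g_pos : ∀ ξ t : ℝ, 0 ≤ t → t < T → 0 < g ξ t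
  ρ_pos : ∀ ξ t : ℝ, 0 ≤ t → t < T → 0 < ρ ξ t
  f_per : ∀ ξ t : ℝ, f (ξ + 2 * π) t = f ξ t
  g_per : ∀ ξ t : ℝ, g (ξ + 2 * π) t = g ξ t
  ρ_per : ∀ ξ t : ℝ, ρ (ξ + 2 * π) t = ρ ξ t
  smooth : ContDiffOn ℝ (⊤ : ℕ∞)
      (fun p : ℝ × ℝ => (f p.1 p.2, g p.1 p.2, ρ p.1 p.2)) (Set.univ ×ˢ Set.Ico 0 T)
  eq_f : ∀ ξ t : ℝ, 0 < t → t < T →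
    pdt f ξ t = Ds ρ (Ds ρ f) ξ t + 2 * (Ds ρ g ξ t / g ξ t) * Ds ρ f ξ t
      - 2 * (f ξ t) ^ 3 / (g ξ t) ^ 4
  eq_g : ∀ ξ t : ℝ, 0 < t → t < T →
    pdt g ξ t = Ds ρ (Ds ρ g) ξ t
      + (Ds ρ f ξ t / f ξ t + Ds ρ g ξ t / g ξ t) * Ds ρ g ξ t
      + 2 * ((f ξ t) ^ 2 - 2 * (g ξ t) ^ 2) / (g ξ t) ^ 3
  eq_ρ : ∀ ξ t : ℝ, 0 < t → t < T →
    pdt (fun x τ => Real.log (ρ x τ)) ξ t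
      = Ds ρ (Ds ρ f) ξ t / f ξ t + 2 * (Ds ρ (Ds ρ g) ξ t / g ξ t)

/-- The Ricci curvature blows up as `t ↗ T`:
`limsup_{t↗T} max_ξ (|κ₀₁+2κ₁₂| + |κ₀₁+2κ₀₂| + |κ₀₂+κ₁₂+κ₂₃|) = ∞`, where the three
displayed quantities are the diagonal components of the Ricci tensor. -/
def RicciBlowup (T : ℝ) (f g ρ : ℝ → ℝ → ℝ) : Prop :=
  ∀ K : ℝ, ∀ t₀ : ℝ, 0 ≤ t₀ → t₀ < T → ∃ ξ t : ℝ, t₀ < t ∧ t < T ∧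
    K < |k01 ρ f ξ t + 2 * k12 ρ f g ξ t| + |k01 ρ f ξ t + 2 * k02 ρ g ξ t|
        + |k02 ρ g ξ t + k12 ρ f g ξ t + k23 ρ f g ξ t|

/-- Assumption A: `f ≤ g` at `t = 0`; `(min_ξ R(ξ,0))·(max_ξ g(ξ,0)²) > −3`;
and the Ricci curvature blows up at the finite time `T`. -/
structure AssumptionA (T : ℝ) (f g ρ : ℝ → ℝ → ℝ) extends WarpedBerger T f g ρ : Prop where
  init_order : ∀ ξ : ℝ, f ξ 0 ≤ g ξ 0
  init_scalar : (⨅ ξ : ℝ, scalR ρ f g ξ 0) * (⨆ ξ : ℝ, (g ξ 0) ^ 2) > -3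
  ricci_blowup : RicciBlowup T f g ρ

/-- Assumption B: Assumption A and, in addition, at `t = 0` one has `f ≥ (1−ε)g` for some
`ε ∈ (0,1)` with `2(1−ε)⁵ + 4(1−ε)⁴ > 4/3`, and `|f_s| ≤ 1` at `t = 0`. -/
structure AssumptionB (T : ℝ) (f g ρ : ℝ → ℝ → ℝ) extends AssumptionA T f g ρ : Prop where
  init_pinched : ∃ ε : ℝ, 0 < ε ∧ ε < 1 ∧ 2 * (1 - ε) ^ 5 + 4 * (1 - ε) ^ 4 > 4 / 3 ∧
    ∀ ξ : ℝ, (1 - ε) * g ξ 0 ≤ f ξ 0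
  init_fs : ∀ ξ : ℝ, |Ds ρ f ξ 0| ≤ 1


/-! ### Calculus infrastructure -/

def Sm (T : ℝ) (φ : ℝ → ℝ → ℝ) : Prop :=
  ContDiffOn ℝ (⊤ : ℕ∞) (fun p : ℝ × ℝ => φ p.1 p.2) (Set.univ ×ˢ Set.Ico 0 T)

def D1 (T : ℝ) (ρ φ ψ : ℝ → ℝ → ℝ) : Prop :=
  ∀ x t : ℝ, 0 ≤ t → t < T → HasDerivAt (fun x => φ x t) (ρ x t * ψ x t) x

def Dt (T : ℝ) (φ ψ : ℝ → ℝ → ℝ) : Prop :=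
  ∀ x t : ℝ, 0 < t → t < T → HasDerivAt (fun τ => φ x τ) (ψ x t) t

theorem uds (T : ℝ) : UniqueDiffOn ℝ (Set.univ ×ˢ Set.Ico 0 T : Set (ℝ × ℝ)) :=
  uniqueDiffOn_univ.prod (uniqueDiffOn_Ico 0 T)

theorem Sm.h1 {T : ℝ} {φ : ℝ → ℝ → ℝ} (h : Sm T φ) (x t : ℝ) (h0 : 0 ≤ t) (hT : t < T) :
    HasDerivAt (fun x => φ x t)
      (fderivWithin ℝ (fun p : ℝ × ℝ => φ p.1 p.2) (Set.univ ×ˢ Set.Ico 0 T) (x, t) (1, 0)) x := by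
  have hd : HasFDerivWithinAt (fun p : ℝ × ℝ => φ p.1 p.2)
      (fderivWithin ℝ (fun p : ℝ × ℝ => φ p.1 p.2) (Set.univ ×ˢ Set.Ico 0 T) (x, t))
      (Set.univ ×ˢ Set.Ico 0 T) (x, t) :=
    ((h.differentiableOn (by simp)) (x, t) ⟨trivial, h0, hT⟩).hasFDerivWithinAt
  have hc : HasDerivAt (fun y : ℝ => ((y, t) : ℝ × ℝ)) (1, 0) x :=
    (hasDerivAt_id x).prodMk (hasDerivAt_const x t)
  have := hd.comp_hasDerivWithinAt (s := Set.univ) (f := fun y : ℝ => ((y, t) : ℝ × ℝ)) x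
    hc.hasDerivWithinAt (fun y _ => ⟨trivial, h0, hT⟩)
  exact (hasDerivWithinAt_univ.mp this)

theorem Sm.pd1_eq {T : ℝ} {φ : ℝ → ℝ → ℝ} (h : Sm T φ) (x t : ℝ) (h0 : 0 ≤ t) (hT : t < T) :
    pd1 φ x t =
      fderivWithin ℝ (fun p : ℝ × ℝ => φ p.1 p.2) (Set.univ ×ˢ Set.Ico 0 T) (x, t) (1, 0) :=
  (h.h1 x t h0 hT).deriv

theorem Sm.hasDeriv1 {T : ℝ} {φ : ℝ → ℝ → ℝ} (h : Sm T φ) (x t : ℝ) (h0 : 0 ≤ t) (hT : t < T) :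
    HasDerivAt (fun x => φ x t) (pd1 φ x t) x := by
  rw [h.pd1_eq x t h0 hT]; exact h.h1 x t h0 hT

theorem Sm.pd1 {T : ℝ} {φ : ℝ → ℝ → ℝ} (h : Sm T φ) : Sm T (pd1 φ) := by
  have h2 : ContDiffOn ℝ (⊤ : ℕ∞)
      (fderivWithin ℝ (fun p : ℝ × ℝ => φ p.1 p.2) (Set.univ ×ˢ Set.Ico 0 T))
      (Set.univ ×ˢ Set.Ico 0 T) :=
    h.fderivWithin (uds T) (by simp)
  have h3 := h2.clm_apply (contDiffOn_const (c := ((1, 0) : ℝ × ℝ)))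
  refine h3.congr ?_
  rintro ⟨x, t⟩ ⟨_, h0, hT⟩
  exact h.pd1_eq x t h0 hT

theorem Sm.at {T : ℝ} {φ : ℝ → ℝ → ℝ} (h : Sm T φ) (x t : ℝ) (h0 : 0 < t) (hT : t < T) :
    ContDiffAt ℝ (⊤ : ℕ∞) (fun p : ℝ × ℝ => φ p.1 p.2) (x, t) :=
  ContDiffOn.contDiffAt h (prod_mem_nhds univ_mem (Ico_mem_nhds h0 hT))

theorem Sm.ht {T : ℝ} {φ : ℝ → ℝ → ℝ} (h : Sm T φ) (x t : ℝ) (h0 : 0 < t) (hT : t < T) :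
    HasDerivAt (fun τ => φ x τ) (fderiv ℝ (fun p : ℝ × ℝ => φ p.1 p.2) (x, t) (0, 1)) t := by
  have hd := ((h.at x t h0 hT).differentiableAt (by simp)).hasFDerivAt
  have hc : HasDerivAt (fun y : ℝ => ((x, y) : ℝ × ℝ)) (0, 1) t :=
    (hasDerivAt_const t x).prodMk (hasDerivAt_id t)
  exact hd.comp_hasDerivAt (f := fun y : ℝ => ((x, y) : ℝ × ℝ)) t hc

theorem Sm.pdt_eq {T : ℝ} {φ : ℝ → ℝ → ℝ} (h : Sm T φ) (x t : ℝ) (h0 : 0 < t) (hT : t < T) :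
    pdt φ x t = fderiv ℝ (fun p : ℝ × ℝ => φ p.1 p.2) (x, t) (0, 1) :=
  (h.ht x t h0 hT).deriv

theorem Sm.hasDerivt {T : ℝ} {φ : ℝ → ℝ → ℝ} (h : Sm T φ) (x t : ℝ) (h0 : 0 < t) (hT : t < T) :
    HasDerivAt (fun τ => φ x τ) (pdt φ x t) t := by
  rw [h.pdt_eq x t h0 hT]; exact h.ht x t h0 hT

theorem Sm.comm {T : ℝ} {φ : ℝ → ℝ → ℝ} (h : Sm T φ) (x t : ℝ) (h0 : 0 < t) (hT : t < T) :
    HasDerivAt (fun x => pdt φ x t) (pdt (_root_.pd1 φ) x t) x := by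
  have h2t : (2 : WithTop ℕ∞) ≤ ((⊤ : ℕ∞) : WithTop ℕ∞) := WithTop.coe_le_coe.2 (le_top (a := (2 : ℕ∞)))
  set Φ : ℝ × ℝ → ℝ := fun p : ℝ × ℝ => φ p.1 p.2 with hΦ
  have hA : ContDiffAt ℝ (⊤ : ℕ∞) Φ (x, t) := h.at x t h0 hT
  have hsym : IsSymmSndFDerivAt ℝ Φ (x, t) := hA.isSymmSndFDerivAt (by simpa using h2t)
  have hF : ContDiffAt ℝ 1 (fderiv ℝ Φ) (x, t) := hA.fderiv_right (m := 1) (by rw [one_add_one_eq_two]; exact h2t)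
  have hFd := (hF.differentiableAt (by simp)).hasFDerivAt
  have hc1 : HasDerivAt (fun y : ℝ => ((y, t) : ℝ × ℝ)) (1, 0) x :=
    (hasDerivAt_id x).prodMk (hasDerivAt_const x t)
  have hc2 : HasDerivAt (fun y : ℝ => ((x, y) : ℝ × ℝ)) (0, 1) t :=
    (hasDerivAt_const t x).prodMk (hasDerivAt_id t)
  have e1 := (hFd.comp_hasDerivAt (f := fun y : ℝ => ((y, t) : ℝ × ℝ)) x hc1).clm_apply
    (hasDerivAt_const x ((0, 1) : ℝ × ℝ))
  have e2 := (hFd.comp_hasDerivAt (f := fun y : ℝ => ((x, y) : ℝ × ℝ)) t hc2).clm_apply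
    (hasDerivAt_const t ((1, 0) : ℝ × ℝ))
  have e3 : pdt (_root_.pd1 φ) x t = fderiv ℝ (fderiv ℝ Φ) (x, t) (0, 1) (1, 0) := by
    have : HasDerivAt (fun τ => _root_.pd1 φ x τ)
        (fderiv ℝ (fderiv ℝ Φ) (x, t) (0, 1) (1, 0)) t := by
      have e2' : HasDerivAt (fun τ => fderiv ℝ Φ (x, τ) (1, 0))
        (fderiv ℝ (fderiv ℝ Φ) (x, t) (0, 1) (1, 0)) t := by simpa using e2
      refine e2'.congr_of_eventuallyEq ?_
      filter_upwards [Ioo_mem_nhds h0 hT] with τ hτ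
      rw [h.pd1_eq x τ hτ.1.le hτ.2]
      rw [fderivWithin_of_mem_nhds (prod_mem_nhds univ_mem (Ico_mem_nhds hτ.1 hτ.2))]
    exact this.deriv
  rw [e3, hsym (0, 1) (1, 0)]
  have e1' : HasDerivAt (fun y => fderiv ℝ Φ (y, t) (0, 1))
        (fderiv ℝ (fderiv ℝ Φ) (x, t) (1, 0) (0, 1)) x := by simpa using e1
  refine e1'.congr_of_eventuallyEq (Eventually.of_forall fun y => ?_)
  exact h.pdt_eq y t h0 hT

theorem Sm.cont {T : ℝ} {φ : ℝ → ℝ → ℝ} (h : Sm T φ) :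
    ContinuousOn (fun p : ℝ × ℝ => φ p.1 p.2) (Set.univ ×ˢ Set.Ico 0 T) := ContDiffOn.continuousOn h

theorem Sm.ds {T : ℝ} {ρ φ : ℝ → ℝ → ℝ} (h : Sm T φ) (hr : Sm T ρ)
    (hp : ∀ x t : ℝ, 0 ≤ t → t < T → 0 < ρ x t) : Sm T (Ds ρ φ) := by
  refine ContDiffOn.div h.pd1 hr ?_
  rintro ⟨x, t⟩ ⟨_, h0, hT⟩
  exact (hp x t h0 hT).ne'

theorem Sm.d1 {T : ℝ} {ρ φ : ℝ → ℝ → ℝ} (h : Sm T φ)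
    (hp : ∀ x t : ℝ, 0 ≤ t → t < T → 0 < ρ x t) : D1 T ρ φ (Ds ρ φ) := by
  intro x t h0 hT
  have := h.hasDeriv1 x t h0 hT
  unfold Ds
  rwa [mul_div_cancel₀ _ (hp x t h0 hT).ne']

/-- commutator -/
theorem Sm.dtds {T : ℝ} {ρ φ χ χ' l : ℝ → ℝ → ℝ} (h : Sm T φ)
    (hp : ∀ x t : ℝ, 0 ≤ t → t < T → 0 < ρ x t) (hl : Dt T ρ (fun x t => ρ x t * l x t))
    (hχ : Dt T φ χ)
    (hχ' : ∀ x t : ℝ, 0 < t → t < T → HasDerivAt (fun x => χ x t) (ρ x t * χ' x t) x) :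
    Dt T (Ds ρ φ) (fun x t => χ' x t - l x t * Ds ρ φ x t) := by
  intro x t h0 hT
  have e1 := h.comm x t h0 hT
  have e2 : (fun x => pdt φ x t) = fun x => χ x t := by
    funext y; exact (hχ y t h0 hT).deriv
  rw [e2] at e1
  have e3 := e1.unique (hχ' x t h0 hT)
  have e4 := h.pd1.hasDerivt x t h0 hT
  rw [e3] at e4
  have hne := (hp x t h0.le hT).ne'
  have := e4.div (hl x t h0 hT) hne
  refine HasDerivAt.congr_deriv (f := fun τ => Ds ρ φ x τ) this ?_
  simp only [Ds]
  field_simp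

theorem pd1_per {φ : ℝ → ℝ → ℝ} {c : ℝ} (h : ∀ x t, φ (x + c) t = φ x t) (x t : ℝ) :
    pd1 φ (x + c) t = pd1 φ x t := by
  unfold pd1
  rw [← deriv_comp_add_const]
  simp only [h]

theorem ds_per {ρ φ : ℝ → ℝ → ℝ} {c : ℝ} (h : ∀ x t, φ (x + c) t = φ x t)
    (hr : ∀ x t, ρ (x + c) t = ρ x t) (x t : ℝ) :
    Ds ρ φ (x + c) t = Ds ρ φ x t := by
  unfold Ds; rw [pd1_per h, hr]

theorem second_test {q r s : ℝ → ℝ} {x0 s2 : ℝ} (hr : ∀ x, 0 < r x)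
    (hq : ∀ x, HasDerivAt q (r x * s x) x) (hs : HasDerivAt s (r x0 * s2) x0) (h0 : s x0 = 0)
    (hmax : ∀ x, q x ≤ q x0) : s2 ≤ 0 := by
  by_contra hc
  push Not at hc
  have hpos : 0 < r x0 * s2 := mul_pos (hr x0) hc
  have ht := (hasDerivAt_iff_tendsto_slope.mp hs).eventually (lt_mem_nhds hpos)
  have ht2 : ∀ᶠ x in 𝓝[>] x0, 0 < slope s x0 x :=
    ht.filter_mono (nhdsWithin_mono _ (fun x hx => ne_of_gt hx))
  obtain ⟨u, hu, hu2⟩ := (mem_nhdsGT_iff_exists_Ioo_subset).mp ht2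
  have hu' : x0 < u := hu
  set m := (x0 + u) / 2 with hm
  have hm1 : x0 < m := by rw [hm]; linarith
  have hm2 : m < u := by rw [hm]; linarith
  obtain ⟨c, hc1, hc2⟩ := exists_hasDerivAt_eq_slope q (fun x => r x * s x) hm1
    (fun x _ => (hq x).continuousAt.continuousWithinAt) (fun x _ => hq x)
  have hsl : 0 < slope s x0 c := hu2 ⟨hc1.1, hc1.2.trans hm2⟩
  rw [slope_def_field, h0, sub_zero] at hsl
  have hcs : 0 < s c := by
    have := mul_pos hsl (sub_pos.mpr hc1.1)
    rwa [div_mul_cancel₀ _ (sub_pos.mpr hc1.1).ne'] at this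
  have h5 : 0 < (q m - q x0) / (m - x0) := by rw [← hc2]; exact mul_pos (hr c) hcs
  have := mul_pos h5 (sub_pos.mpr hm1)
  rw [div_mul_cancel₀ _ (sub_pos.mpr hm1).ne'] at this
  linarith [hmax m]

theorem per_red {q : ℝ → ℝ} (per : ∀ x, q (x + 2 * π) = q x) (x : ℝ) :
    ∃ y ∈ Set.Icc (0 : ℝ) (2 * π), q x = q y := by
  have hp : Function.Periodic q (2 * π) := per
  obtain ⟨y, hy, h⟩ := hp.exists_mem_Ico₀ (by positivity) x
  exact ⟨y, ⟨hy.1, hy.2.le⟩, h⟩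

theorem init_bdd {T : ℝ} {Q : ℝ → ℝ → ℝ} (hT : 0 < T)
    (hc : ContinuousOn (fun p : ℝ × ℝ => Q p.1 p.2) (Set.univ ×ˢ Set.Ico 0 T))
    (per : ∀ x t, Q (x + 2 * π) t = Q x t) : ∃ C, 0 < C ∧ ∀ x, Q x 0 ≤ C := by
  have hcc : Continuous (fun x => Q x 0) := by
    rw [← continuousOn_univ]
    exact hc.comp (f := fun x : ℝ => ((x, 0) : ℝ × ℝ)) (by fun_prop)
      (fun x _ => ⟨trivial, le_refl _, hT⟩)
  obtain ⟨C, hC⟩ := (isCompact_Icc (a := (0 : ℝ)) (b := 2 * π)).bddAbove_image hcc.continuousOn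
  refine ⟨max C 1, by positivity, fun x => ?_⟩
  obtain ⟨y, hy, h⟩ := per_red (q := fun x => Q x 0) (fun x => per x 0) x
  rw [h]
  exact (hC ⟨y, hy, rfl⟩).trans (le_max_left _ _)

theorem MP {T : ℝ} {ρ Q Qs Qss Qt : ℝ → ℝ → ℝ}
    (hp : ∀ x t : ℝ, 0 ≤ t → t < T → 0 < ρ x t)
    (hc : ContinuousOn (fun p : ℝ × ℝ => Q p.1 p.2) (Set.univ ×ˢ Set.Ico 0 T))
    (per : ∀ x t, Q (x + 2 * π) t = Q x t) (h1 : D1 T ρ Q Qs) (h2 : D1 T ρ Qs Qss)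
    (ht : Dt T Q Qt) (C : ℝ) (hi : ∀ x, Q x 0 ≤ C)
    (hstep : ∀ x t, 0 < t → t < T → Qs x t = 0 → Qss x t ≤ 0 → C < Q x t → Qt x t ≤ 0) :
    ∀ x t, 0 ≤ t → t < T → Q x t ≤ C := by
  intro x1 t1 h0 hT
  by_contra hcon
  push Not at hcon
  obtain ⟨y1, hy1, hxy⟩ := per_red (q := fun x => Q x t1) (fun x => per x t1) x1
  rw [hxy] at hcon
  obtain ⟨ε, he, he2⟩ : ∃ ε > 0, C < Q y1 t1 - ε * t1 := by
    refine ⟨(Q y1 t1 - C) / (2 * (t1 + 1)), by apply div_pos <;> linarith, ?_⟩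
    have h3 : (Q y1 t1 - C) / (2 * (t1 + 1)) * t1 ≤ (Q y1 t1 - C) / 2 := by
      rw [div_mul_eq_mul_div, div_le_div_iff₀ (by linarith) (by norm_num)]
      nlinarith
    linarith
  have hK : IsCompact (Set.Icc (0 : ℝ) (2 * π) ×ˢ Set.Icc (0 : ℝ) t1) :=
    isCompact_Icc.prod isCompact_Icc
  have hcK : ContinuousOn (fun p : ℝ × ℝ => Q p.1 p.2 - ε * p.2)
      (Set.Icc (0 : ℝ) (2 * π) ×ˢ Set.Icc (0 : ℝ) t1) := by
    refine (hc.mono ?_).sub (by fun_prop)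
    rintro ⟨x, t⟩ ⟨_, h⟩
    exact ⟨trivial, h.1, h.2.trans_lt hT⟩
  obtain ⟨⟨x, t⟩, ⟨hx, htm⟩, hmax⟩ := hK.exists_isMaxOn ⟨(y1, t1), hy1, h0, le_refl _⟩ hcK
  have hmax' : ∀ y s, y ∈ Set.Icc (0 : ℝ) (2 * π) → s ∈ Set.Icc (0 : ℝ) t1 →
      Q y s - ε * s ≤ Q x t - ε * t := fun y s hy hs => hmax (a := (y, s)) ⟨hy, hs⟩
  have htm0 : 0 ≤ t := htm.1
  have htT : t < T := htm.2.trans_lt hT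
  have hbig : C < Q x t - ε * t := he2.trans_le (hmax' y1 t1 hy1 ⟨h0, le_refl _⟩)
  have hQ : C < Q x t := by nlinarith
  have htpos : 0 < t := by
    rcases htm0.eq_or_lt with h | h
    · rw [← h] at hQ; linarith [hi x]
    · exact h
  have hsp : ∀ y, Q y t ≤ Q x t := by
    intro y
    obtain ⟨z, hz, h⟩ := per_red (q := fun x => Q x t) (fun x => per x t) y
    rw [h]; linarith [hmax' z t hz htm]
  have hs0 : Qs x t = 0 := by
    have h3 : IsLocalMax (fun y => Q y t) x := Eventually.of_forall hsp
    have := h3.hasDerivAt_eq_zero (h1 x t htm0 htT)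
    exact (mul_eq_zero.mp this).resolve_left (hp x t htm0 htT).ne'
  have hss : Qss x t ≤ 0 := second_test (q := fun y => Q y t) (r := fun y => ρ y t)
    (s := fun y => Qs y t) (fun y => hp y t htm0 htT) (fun y => h1 y t htm0 htT)
    (h2 x t htm0 htT) hs0 hsp
  have hneg := hstep x t htpos htT hs0 hss hQ
  have hd := (ht x t htpos htT).hasDerivWithinAt (s := Set.Iio t)
  have hge : ε ≤ Qt x t := by
    rw [hasDerivWithinAt_iff_tendsto_slope' (by simp)] at hd
    refine ge_of_tendsto hd ?_
    filter_upwards [Ioo_mem_nhdsLT htpos] with s hs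
    rw [slope_comm, slope_def_field, le_div_iff₀ (by linarith [hs.2])]
    have := hmax' x s hx ⟨hs.1.le, hs.2.le.trans htm.2⟩
    linarith
  linarith

/-! ### The flow in logarithmic variables -/

structure BFlow (T : ℝ) (ρ F G a b a1 b1 a2 b2 a3 b3 N P : ℝ → ℝ → ℝ) : Prop where
  Tpos : 0 < T
  rpos : ∀ x t : ℝ, 0 ≤ t → t < T → 0 < ρ x t
  eN : ∀ x t, N x t = Real.exp (-2 * G x t)
  eP : ∀ x t, P x t = Real.exp (2 * F x t - 4 * G x t)
  sF : Sm T F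
  sG : Sm T G
  sa : Sm T a
  sb : Sm T b
  sa1 : Sm T a1
  sb1 : Sm T b1
  pF : ∀ x t, F (x + 2 * π) t = F x t
  pG : ∀ x t, G (x + 2 * π) t = G x t
  pa : ∀ x t, a (x + 2 * π) t = a x t
  pb : ∀ x t, b (x + 2 * π) t = b x t
  pa1 : ∀ x t, a1 (x + 2 * π) t = a1 x t
  pb1 : ∀ x t, b1 (x + 2 * π) t = b1 x t
  dF : D1 T ρ F a
  dG : D1 T ρ G b
  da : D1 T ρ a a1
  db : D1 T ρ b b1
  da1 : D1 T ρ a1 a2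
  db1 : D1 T ρ b1 b2
  da2 : D1 T ρ a2 a3
  db2 : D1 T ρ b2 b3
  dN : D1 T ρ N (fun x t => -2 * b x t * N x t)
  dP : D1 T ρ P (fun x t => (2 * a x t - 4 * b x t) * P x t)
  tF : Dt T F (fun x t => a1 x t + a x t * a x t + 2 * (a x t * b x t) - 2 * P x t)
  tG : Dt T G (fun x t => b1 x t + 2 * (b x t * b x t) + a x t * b x t + 2 * P x t - 4 * N x t)
  ta : Dt T a (fun x t => a2 x t + a x t * a1 x t + 2 * a1 x t * b x t - a x t ^ 3
    - 2 * a x t * b x t ^ 2 - 4 * a x t * P x t + 8 * b x t * P x t)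
  tb : Dt T b (fun x t => b2 x t + 2 * b x t * b1 x t + a x t * b1 x t - a x t ^ 2 * b x t
    - 2 * b x t ^ 3 + 4 * a x t * P x t - 8 * b x t * P x t + 8 * b x t * N x t)
  ta1 : Dt T a1 (fun x t => a3 x t + a1 x t ^ 2 + a x t * a2 x t + 2 * a2 x t * b x t
    + 2 * a1 x t * b1 x t - 3 * a x t ^ 2 * a1 x t - 2 * a1 x t * b x t ^ 2
    - 4 * a x t * b x t * b1 x t - 4 * a1 x t * P x t
    - 4 * a x t * (2 * a x t - 4 * b x t) * P x t
    + 8 * b1 x t * P x t + 8 * b x t * (2 * a x t - 4 * b x t) * P x t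
    - (a1 x t + a x t ^ 2 + 2 * b1 x t + 2 * b x t ^ 2) * a1 x t)
  tb1 : Dt T b1 (fun x t => b3 x t + 2 * b1 x t ^ 2 + 2 * b x t * b2 x t + a1 x t * b1 x t
    + a x t * b2 x t - 2 * a x t * a1 x t * b x t - a x t ^ 2 * b1 x t - 6 * b x t ^ 2 * b1 x t
    + 4 * a1 x t * P x t + 4 * a x t * (2 * a x t - 4 * b x t) * P x t - 8 * b1 x t * P x t
    - 8 * b x t * (2 * a x t - 4 * b x t) * P x t + 8 * b1 x t * N x t - 16 * b x t ^ 2 * N x t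
    - (a1 x t + a x t ^ 2 + 2 * b1 x t + 2 * b x t ^ 2) * b1 x t)
  tN : Dt T N (fun x t =>
    -2 * (b1 x t + 2 * (b x t * b x t) + a x t * b x t + 2 * P x t - 4 * N x t) * N x t)
  tP : Dt T P (fun x t =>
    (2 * (a1 x t + a x t * a x t + 2 * (a x t * b x t) - 2 * P x t)
    - 4 * (b1 x t + 2 * (b x t * b x t) + a x t * b x t + 2 * P x t - 4 * N x t)) * P x t)

theorem log_ds {T : ℝ} {ρ f : ℝ → ℝ → ℝ} (sf : Sm T f)
    (fp : ∀ x t : ℝ, 0 ≤ t → t < T → 0 < f x t) (x t : ℝ) (h0 : 0 ≤ t) (hT : t < T) :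
    Ds ρ f x t = f x t * Ds ρ (fun x t => Real.log (f x t)) x t := by
  have h := (sf.hasDeriv1 x t h0 hT).log (fp x t h0 hT).ne'
  have h2 : pd1 (fun x t => Real.log (f x t)) x t = pd1 f x t / f x t := h.deriv
  unfold Ds
  rw [h2]
  have := (fp x t h0 hT).ne'
  field_simp

theorem log_dss {T : ℝ} {ρ f : ℝ → ℝ → ℝ} (sf : Sm T f) (sr : Sm T ρ)
    (hp : ∀ x t : ℝ, 0 ≤ t → t < T → 0 < ρ x t)
    (fp : ∀ x t : ℝ, 0 ≤ t → t < T → 0 < f x t)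
    (sF : Sm T (fun x t => Real.log (f x t))) (x t : ℝ) (h0 : 0 ≤ t) (hT : t < T) :
    Ds ρ (Ds ρ f) x t = f x t * (Ds ρ (Ds ρ (fun x t => Real.log (f x t))) x t
      + Ds ρ (fun x t => Real.log (f x t)) x t ^ 2) := by
  have e : (fun x => Ds ρ f x t) = fun x => f x t * Ds ρ (fun x t => Real.log (f x t)) x t := by
    funext y; exact log_ds sf fp y t h0 hT
  have h1 := sf.d1 hp x t h0 hT
  have h2 := (sF.ds sr hp).d1 hp x t h0 hT
  have h3 := (h1.mul h2).deriv
  have h4 : pd1 (Ds ρ f) x t = ρ x t * (f x t * (Ds ρ (Ds ρ (fun x t => Real.log (f x t))) x t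
      + Ds ρ (fun x t => Real.log (f x t)) x t ^ 2)) := by
    unfold pd1
    rw [e]
    refine Eq.trans h3 ?_
    rw [log_ds sf fp x t h0 hT]
    ring
  have := (hp x t h0 hT).ne'
  change pd1 (Ds ρ f) x t / ρ x t = _
  rw [h4]
  field_simp

theorem flow_of {T : ℝ} {f g ρ : ℝ → ℝ → ℝ} (sol : WarpedBerger T f g ρ) :
    ∃ F G a b a1 b1 a2 b2 a3 b3 N P : ℝ → ℝ → ℝ,
      BFlow T ρ F G a b a1 b1 a2 b2 a3 b3 N P ∧
      (∀ x t, 0 ≤ t → t < T → f x t = Real.exp (F x t) ∧ g x t = Real.exp (G x t) ∧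
        Ds ρ f x t = f x t * a x t ∧
        k01 ρ f x t = -(a1 x t + a x t ^ 2) ∧ k02 ρ g x t = -(b1 x t + b x t ^ 2)) := by
  have sf : Sm T f := sol.smooth.fst
  have sg : Sm T g := sol.smooth.snd.fst
  have sr : Sm T ρ := sol.smooth.snd.snd
  have hp := sol.ρ_pos
  set F : ℝ → ℝ → ℝ := fun x t => Real.log (f x t) with hF
  set G : ℝ → ℝ → ℝ := fun x t => Real.log (g x t) with hG
  have sF : Sm T F := ContDiffOn.log sf (fun p hq => (sol.f_pos p.1 p.2 hq.2.1 hq.2.2).ne')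
  have sG : Sm T G := ContDiffOn.log sg (fun p hq => (sol.g_pos p.1 p.2 hq.2.1 hq.2.2).ne')
  have pF : ∀ x t, F (x + 2 * π) t = F x t := fun x t => by simp only [hF, sol.f_per]
  have pG : ∀ x t, G (x + 2 * π) t = G x t := fun x t => by simp only [hG, sol.g_per]
  have fF : ∀ x t, 0 ≤ t → t < T → f x t = Real.exp (F x t) := fun x t h0 hT =>
    (Real.exp_log (sol.f_pos x t h0 hT)).symm
  have gG : ∀ x t, 0 ≤ t → t < T → g x t = Real.exp (G x t) := fun x t h0 hT =>
    (Real.exp_log (sol.g_pos x t h0 hT)).symm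
  have lf1 := fun x t h0 hT => log_ds (ρ := ρ) sf sol.f_pos x t h0 hT
  have lg1 := fun x t h0 hT => log_ds (ρ := ρ) sg sol.g_pos x t h0 hT
  have lf2 := fun x t h0 hT => log_dss sf sr hp sol.f_pos sF x t h0 hT
  have lg2 := fun x t h0 hT => log_dss sg sr hp sol.g_pos sG x t h0 hT
  rw [← hF] at lf1 lf2
  rw [← hG] at lg1 lg2
  obtain ⟨a, ha⟩ : ∃ a, a = Ds ρ F := ⟨_, rfl⟩
  obtain ⟨b, hb⟩ : ∃ b, b = Ds ρ G := ⟨_, rfl⟩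
  obtain ⟨a1, ha1⟩ : ∃ a1, a1 = Ds ρ a := ⟨_, rfl⟩
  obtain ⟨b1, hb1⟩ : ∃ b1, b1 = Ds ρ b := ⟨_, rfl⟩
  obtain ⟨a2, ha2⟩ : ∃ a2, a2 = Ds ρ a1 := ⟨_, rfl⟩
  obtain ⟨b2, hb2⟩ : ∃ b2, b2 = Ds ρ b1 := ⟨_, rfl⟩
  obtain ⟨a3, ha3⟩ : ∃ a3, a3 = Ds ρ a2 := ⟨_, rfl⟩
  obtain ⟨b3, hb3⟩ : ∃ b3, b3 = Ds ρ b2 := ⟨_, rfl⟩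
  obtain ⟨N, eN⟩ : ∃ N : ℝ → ℝ → ℝ, ∀ x t, N x t = Real.exp (-2 * G x t) := ⟨_, fun _ _ => rfl⟩
  obtain ⟨P, eP⟩ : ∃ P : ℝ → ℝ → ℝ, ∀ x t, P x t = Real.exp (2 * F x t - 4 * G x t) :=
    ⟨_, fun _ _ => rfl⟩
  have eN' : N = fun x t => Real.exp (-2 * G x t) := by funext x t; exact eN x t
  have eP' : P = fun x t => Real.exp (2 * F x t - 4 * G x t) := by funext x t; exact eP x t
  rw [← ha] at lf1 lf2
  rw [← hb] at lg1 lg2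
  rw [← ha1] at lf2
  rw [← hb1] at lg2
  have sa : Sm T a := ha ▸ sF.ds sr hp
  have sb : Sm T b := hb ▸ sG.ds sr hp
  have sa1 : Sm T a1 := ha1 ▸ sa.ds sr hp
  have sb1 : Sm T b1 := hb1 ▸ sb.ds sr hp
  have sa2 : Sm T a2 := ha2 ▸ sa1.ds sr hp
  have sb2 : Sm T b2 := hb2 ▸ sb1.ds sr hp
  have pa : ∀ x t, a (x + 2 * π) t = a x t := ha ▸ ds_per pF sol.ρ_per
  have pb : ∀ x t, b (x + 2 * π) t = b x t := hb ▸ ds_per pG sol.ρ_per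
  have pa1 : ∀ x t, a1 (x + 2 * π) t = a1 x t := ha1 ▸ ds_per pa sol.ρ_per
  have pb1 : ∀ x t, b1 (x + 2 * π) t = b1 x t := hb1 ▸ ds_per pb sol.ρ_per
  have dF : D1 T ρ F a := ha ▸ sF.d1 hp
  have dG : D1 T ρ G b := hb ▸ sG.d1 hp
  have da : D1 T ρ a a1 := ha1 ▸ sa.d1 hp
  have db : D1 T ρ b b1 := hb1 ▸ sb.d1 hp
  have da1 : D1 T ρ a1 a2 := ha2 ▸ sa1.d1 hp
  have db1 : D1 T ρ b1 b2 := hb2 ▸ sb1.d1 hp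
  have da2 : D1 T ρ a2 a3 := ha3 ▸ sa2.d1 hp
  have db2 : D1 T ρ b2 b3 := hb3 ▸ sb2.d1 hp
  have dN : D1 T ρ N (fun x t => -2 * b x t * N x t) := by
    intro x t h0 hT
    rw [eN']
    refine (((dG x t h0 hT).const_mul (-2)).exp).congr_deriv ?_
    ring
  have dP : D1 T ρ P (fun x t => (2 * a x t - 4 * b x t) * P x t) := by
    intro x t h0 hT
    rw [eP']
    refine ((((dF x t h0 hT).const_mul 2).sub ((dG x t h0 hT).const_mul 4)).exp).congr_deriv ?_
    simp only [Pi.sub_apply]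
    ring
  have vN : ∀ x t, 0 ≤ t → t < T → N x t = 1 / g x t ^ 2 := by
    intro x t h0 hT
    rw [eN, gG x t h0 hT, ← Real.exp_nat_mul, one_div, ← Real.exp_neg]
    congr 1; push_cast; ring
  have vP : ∀ x t, 0 ≤ t → t < T → P x t = f x t ^ 2 / g x t ^ 4 := by
    intro x t h0 hT
    rw [eP, gG x t h0 hT, fF x t h0 hT, ← Real.exp_nat_mul, ← Real.exp_nat_mul, ← Real.exp_sub]
    congr 1
  have tF : Dt T F (fun x t => a1 x t + a x t * a x t + 2 * (a x t * b x t) - 2 * P x t) := by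
    intro x t h0 hT
    have hf := (sol.f_pos x t h0.le hT).ne'
    have hg := (sol.g_pos x t h0.le hT).ne'
    refine ((sf.hasDerivt x t h0 hT).log hf).congr_deriv ?_
    beta_reduce
    rw [sol.eq_f x t h0 hT, lf2 x t h0.le hT, lf1 x t h0.le hT, lg1 x t h0.le hT,
      vP x t h0.le hT]
    field_simp
  have tG : Dt T G (fun x t => b1 x t + 2 * (b x t * b x t) + a x t * b x t + 2 * P x t
      - 4 * N x t) := by
    intro x t h0 hT
    have hf := (sol.f_pos x t h0.le hT).ne'
    have hg := (sol.g_pos x t h0.le hT).ne'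
    refine ((sg.hasDerivt x t h0 hT).log hg).congr_deriv ?_
    beta_reduce
    rw [sol.eq_g x t h0 hT, lg2 x t h0.le hT, lf1 x t h0.le hT, lg1 x t h0.le hT,
      vP x t h0.le hT, vN x t h0.le hT]
    field_simp
    ring
  have tr : Dt T ρ (fun x t => ρ x t *
      (fun x t => a1 x t + a x t ^ 2 + 2 * b1 x t + 2 * b x t ^ 2) x t) := by
    intro x t h0 hT
    have hf := (sol.f_pos x t h0.le hT).ne'
    have hg := (sol.g_pos x t h0.le hT).ne'
    have hr := (hp x t h0.le hT).ne'
    have h1 := sr.hasDerivt x t h0 hT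
    have h2 : pdt (fun x τ => Real.log (ρ x τ)) x t = pdt ρ x t / ρ x t := (h1.log hr).deriv
    rw [sol.eq_ρ x t h0 hT, lf2 x t h0.le hT, lg2 x t h0.le hT] at h2
    refine h1.congr_deriv ?_
    rw [eq_div_iff hr] at h2
    rw [← h2]
    field_simp
    ring
  have ta : Dt T a (fun x t => a2 x t + a x t * a1 x t + 2 * a1 x t * b x t - a x t ^ 3
    - 2 * a x t * b x t ^ 2 - 4 * a x t * P x t + 8 * b x t * P x t) := by
    have h := sF.dtds (χ' := fun x t => a2 x t + 2 * (a x t * a1 x t) + 2 * (a1 x t * b x t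
      + a x t * b1 x t) - 2 * ((2 * a x t - 4 * b x t) * P x t)) hp tr tF ?_
    · intro x t h0 hT
      rw [ha]
      refine (h x t h0 hT).congr_deriv ?_
      rw [← ha]
      ring
    · intro x t h0 hT
      have A := da x t h0.le hT
      have A1 := da1 x t h0.le hT
      have B := db x t h0.le hT
      refine ((((A1.add (A.mul A)).add ((A.mul B).const_mul 2)).sub
        ((dP x t h0.le hT).const_mul 2))).congr_deriv ?_
      ring
  have tb : Dt T b (fun x t => b2 x t + 2 * b x t * b1 x t + a x t * b1 x t - a x t ^ 2 * b x t
    - 2 * b x t ^ 3 + 4 * a x t * P x t - 8 * b x t * P x t + 8 * b x t * N x t) := by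
    have h := sG.dtds (χ' := fun x t => b2 x t + 4 * (b x t * b1 x t) + (a1 x t * b x t
      + a x t * b1 x t) + 2 * ((2 * a x t - 4 * b x t) * P x t) + 8 * b x t * N x t) hp tr tG ?_
    · intro x t h0 hT
      rw [hb]
      refine (h x t h0 hT).congr_deriv ?_
      rw [← hb]
      ring
    · intro x t h0 hT
      have A := da x t h0.le hT
      have B1 := db1 x t h0.le hT
      have B := db x t h0.le hT
      refine ((((B1.add ((B.mul B).const_mul 2)).add (A.mul B)).add
        ((dP x t h0.le hT).const_mul 2)).sub ((dN x t h0.le hT).const_mul 4)).congr_deriv ?_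
      ring
  have ta1 := sa.dtds (χ' := fun x t => a3 x t + a1 x t ^ 2 + a x t * a2 x t + 2 * a2 x t * b x t
    + 2 * a1 x t * b1 x t - 3 * a x t ^ 2 * a1 x t - 2 * a1 x t * b x t ^ 2
    - 4 * a x t * b x t * b1 x t - 4 * a1 x t * P x t
    - 4 * a x t * (2 * a x t - 4 * b x t) * P x t
    + 8 * b1 x t * P x t + 8 * b x t * (2 * a x t - 4 * b x t) * P x t) hp tr ta (by
      intro x t h0 hT
      have A := da x t h0.le hT
      have A1 := da1 x t h0.le hT
      have A2 := da2 x t h0.le hT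
      have B := db x t h0.le hT
      have dp := dP x t h0.le hT
      refine (((((((A2.add (A.mul A1)).add ((A1.const_mul 2).mul B)).sub (A.pow 3)).sub
        ((A.const_mul 2).mul (B.pow 2))).sub ((A.const_mul 4).mul dp)).add
        ((B.const_mul 8).mul dp))).congr_deriv ?_
      simp only [Pi.mul_apply, Pi.pow_apply]
      ring)
  have tb1 := sb.dtds (χ' := fun x t => b3 x t + 2 * b1 x t ^ 2 + 2 * b x t * b2 x t
    + a1 x t * b1 x t
    + a x t * b2 x t - 2 * a x t * a1 x t * b x t - a x t ^ 2 * b1 x t - 6 * b x t ^ 2 * b1 x t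
    + 4 * a1 x t * P x t + 4 * a x t * (2 * a x t - 4 * b x t) * P x t - 8 * b1 x t * P x t
    - 8 * b x t * (2 * a x t - 4 * b x t) * P x t + 8 * b1 x t * N x t
    - 16 * b x t ^ 2 * N x t) hp tr tb (by
      intro x t h0 hT
      have A := da x t h0.le hT
      have B1 := db1 x t h0.le hT
      have B2 := db2 x t h0.le hT
      have B := db x t h0.le hT
      have dp := dP x t h0.le hT
      have dn := dN x t h0.le hT
      refine ((((((((B2.add ((B.const_mul 2).mul B1)).add (A.mul B1)).sub ((A.pow 2).mul B)).sub
        ((B.pow 3).const_mul 2)).add ((A.const_mul 4).mul dp)).sub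
        ((B.const_mul 8).mul dp))).add ((B.const_mul 8).mul dn)).congr_deriv ?_
      simp only [Pi.mul_apply, Pi.pow_apply]
      ring)
  rw [← ha1] at ta1
  rw [← hb1] at tb1
  refine ⟨F, G, a, b, a1, b1, a2, b2, a3, b3, N, P, ⟨sol.T_pos, hp, eN, eP, sF, sG, sa, sb, sa1,
    sb1, pF, pG, pa, pb, pa1, pb1, dF, dG, da, db, da1, db1, da2, db2, dN, dP, tF, tG, ta, tb,
    ta1, tb1, ?_, ?_⟩, ?_⟩
  · intro x t h0 hT
    rw [eN']
    refine (((tG x t h0 hT).const_mul (-2)).exp).congr_deriv ?_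
    simp only [← eN]
    ring
  · intro x t h0 hT
    rw [eP']
    refine ((((tF x t h0 hT).const_mul 2).sub ((tG x t h0 hT).const_mul 4)).exp).congr_deriv ?_
    simp only [Pi.sub_apply, ← eP]
    ring
  · intro x t h0 hT
    have hf := (sol.f_pos x t h0 hT).ne'
    have hg := (sol.g_pos x t h0 hT).ne'
    refine ⟨fF x t h0 hT, gG x t h0 hT, lf1 x t h0 hT, ?_, ?_⟩
    · rw [k01, lf2 x t h0 hT]; field_simp
    · rw [k02, lg2 x t h0 hT]; field_simp

/-! ### Algebraic inequalities at extremal points -/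

theorem alg4 {a b a1 a2 P X : ℝ} (hX : 0 < X) (hP : 0 < P) (hXP : X * P ≤ 1)
    (hs : X * (2 * a * (a1 + a ^ 2)) = 0)
    (hss : X * (2 * ((a1 + a ^ 2) * (a1 + 2 * a ^ 2) + a * (a2 + 2 * a * a1))) ≤ 0)
    (hQ : 4 / 3 < X * (a * a)) :
    X * (2 * a * (a2 + a * a1 + 2 * a1 * b - a ^ 3 - 2 * a * b ^ 2 - 4 * a * P + 8 * b * P)
      + 2 * a ^ 2 * (a1 + a * a + 2 * (a * b) - 2 * P)) ≤ 0 := by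
  have ha : a ≠ 0 := by rintro rfl; norm_num at hQ
  have e : a1 = -a ^ 2 := by
    have h1 := (mul_eq_zero.mp hs).resolve_left hX.ne'
    have h2 := (mul_eq_zero.mp h1).resolve_left (by simpa using ha)
    linarith
  subst e
  have h3 := nonpos_of_mul_nonpos_right hss hX
  have h4 : 4 / 3 * P < a ^ 2 := by
    by_contra hc
    push Not at hc
    have := mul_le_mul_of_nonneg_left hc hX.le
    nlinarith
  have h5 : 0 ≤ P * (3 * a ^ 2 - 4 * P) := mul_nonneg hP.le (by linarith)
  have h6 : 2 * a * (a2 + a * -a ^ 2 + 2 * -a ^ 2 * b - a ^ 3 - 2 * a * b ^ 2 - 4 * a * P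
      + 8 * b * P) + 2 * a ^ 2 * (-a ^ 2 + a * a + 2 * (a * b) - 2 * P) ≤ 0 := by
    nlinarith [sq_nonneg (a * b - 2 * P)]
  have := mul_nonpos_of_nonneg_of_nonpos hX.le h6
  linarith

theorem alg5 {a b b1 b2 N P Y : ℝ} (hY : 0 < Y) (hP : 0 < P) (hPN : P ≤ N) (hYN : Y * N = 1)
    (hs : Y * (2 * b * (b1 + b ^ 2)) = 0)
    (hss : Y * (2 * ((b1 + b ^ 2) * (b1 + 2 * b ^ 2) + b * (b2 + 2 * b * b1))) ≤ 0)
    (hQ : 5 < Y * (b * b)) :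
    Y * (2 * b * (b2 + 2 * b * b1 + a * b1 - a ^ 2 * b
    - 2 * b ^ 3 + 4 * a * P - 8 * b * P + 8 * b * N)
      + 2 * b ^ 2 * (b1 + 2 * (b * b) + a * b + 2 * P - 4 * N)) ≤ 0 := by
  have ha : b ≠ 0 := by rintro rfl; norm_num at hQ
  have e : b1 = -b ^ 2 := by
    have h1 := (mul_eq_zero.mp hs).resolve_left hY.ne'
    have h2 := (mul_eq_zero.mp h1).resolve_left (by simpa using ha)
    linarith
  subst e
  have h3 := nonpos_of_mul_nonpos_right hss hY
  have hN : 0 < N := hP.trans_le hPN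
  have h4 : 5 * N < b ^ 2 := by
    by_contra hc
    push Not at hc
    have := mul_le_mul_of_nonneg_left hc hY.le
    nlinarith
  have h5 : 0 ≤ b ^ 2 * (b ^ 2 - 5 * N) := mul_nonneg (sq_nonneg b) (by linarith)
  have h6 : 0 ≤ N * (b ^ 2 - 5 * N) := mul_nonneg hN.le (by linarith)
  have h7 : P ^ 2 ≤ N ^ 2 := by nlinarith
  have h8 : 0 ≤ b ^ 2 * P := by positivity
  refine mul_nonpos_of_nonneg_of_nonpos hY.le ?_
  nlinarith [sq_nonneg (a * b - 2 * P)]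

theorem alg6 {i j a b a1 b1 N P x : ℝ} (hi : 0 < i) (hji : j ≤ i) (hx : 0 < x) (hxj : x * i ≤ j)
    (hx2 : 4 / 3 < 2 * x ^ 5 + 4 * x ^ 4)
    (hN : N = j ^ 2) (hP : P * i ^ 2 = j ^ 4) (ha : a ^ 2 ≤ 4 / 3 * i ^ 2)
    (hs : -(a * i) + b * j = 0) (hss : i * (a ^ 2 - a1) + j * (b1 - b ^ 2) ≤ 0) :
    -(i * (a1 + a * a + 2 * (a * b) - 2 * P))
      + j * (b1 + 2 * (b * b) + a * b + 2 * P - 4 * N) ≤ 0 := by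
  obtain ⟨u, rfl⟩ : ∃ u, j = u * i := ⟨j / i, by field_simp⟩
  have hu1 : u ≤ 1 := by
    by_contra hc; push Not at hc; nlinarith
  have hux : x ≤ u := by
    by_contra hc; push Not at hc; nlinarith
  have hu : 0 < u := hx.trans_le hux
  have hP' : P = u ^ 4 * i ^ 2 := by
    have : i ^ 2 ≠ 0 := by positivity
    apply mul_right_cancel₀ this
    rw [hP]; ring
  have hab : a = u * b := by
    apply mul_right_cancel₀ hi.ne'
    linarith
  subst hN hP' hab
  have h1 : x ^ 5 ≤ u ^ 5 := pow_le_pow_left₀ hx.le hux 5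
  have h2 : x ^ 4 ≤ u ^ 4 := pow_le_pow_left₀ hx.le hux 4
  have h3 : b ^ 2 ≤ 2 * u ^ 2 * (u + 2) * i ^ 2 := by
    have h4 : u ^ 2 * b ^ 2 ≤ u ^ 2 * (2 * u ^ 2 * (u + 2) * i ^ 2) := by
      have : 4 / 3 * i ^ 2 ≤ (2 * u ^ 5 + 4 * u ^ 4) * i ^ 2 :=
        mul_le_mul_of_nonneg_right (by linarith) (sq_nonneg i)
      nlinarith
    exact le_of_mul_le_mul_left h4 (by positivity)
  have h5 : 0 ≤ i * u * (1 - u) * (2 * u ^ 2 * (u + 2) * i ^ 2 - b ^ 2) :=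
    mul_nonneg (mul_nonneg (by positivity) (by linarith)) (by linarith)
  nlinarith

theorem alg7 {a b a1 b1 a2 b2 N P D : ℝ} (hP : 0 < P) (hD : 0 ≤ D) (hb : |(N - P) * b| ≤ D * P)
    (hs : 2 * (a - b) * (a1 - b1) = 0)
    (hss : 2 * (a1 - b1) ^ 2 + 2 * (a - b) * (a2 - b2) ≤ 0) (hQ : D ^ 2 < (a - b) * (a - b)) :
    2 * (a - b) * ((a2 + a * a1 + 2 * a1 * b - a ^ 3 - 2 * a * b ^ 2 - 4 * a * P + 8 * b * P)
      - (b2 + 2 * b * b1 + a * b1 - a ^ 2 * b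
    - 2 * b ^ 3 + 4 * a * P - 8 * b * P + 8 * b * N)) ≤ 0 := by
  have hy : D < |a - b| := by
    have : D ^ 2 < |a - b| ^ 2 := by rw [sq_abs]; nlinarith
    exact lt_of_pow_lt_pow_left₀ 2 (abs_nonneg _) this
  have hne : a - b ≠ 0 := by
    intro h; rw [h] at hy; simp at hy; linarith
  have e : a1 = b1 := by
    have := (mul_eq_zero.mp hs).resolve_left (by simpa using hne)
    linarith
  subst e
  have h1 : |(N - P) * b * (a - b)| ≤ P * (a - b) ^ 2 := by
    rw [abs_mul, ← sq_abs (a - b)]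
    have := mul_le_mul_of_nonneg_right hb (abs_nonneg (a - b))
    have h3 : D * (P * |a - b|) ≤ |a - b| * (P * |a - b|) :=
      mul_le_mul_of_nonneg_right hy.le (by positivity)
    nlinarith
  have h2 := neg_le_of_abs_le h1
  have h3 : 0 ≤ (a - b) ^ 2 * (a ^ 2 + 2 * b ^ 2) := by positivity
  nlinarith

theorem abs_prod2 {x y A B : ℝ} (hx : |x| ≤ A) (hy : |y| ≤ B) : |x * y| ≤ A * B := by
  rw [abs_mul]
  exact mul_le_mul hx hy (abs_nonneg _) ((abs_nonneg _).trans hx)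

theorem alg8S {y b r P NP j D B M V : ℝ} (hj : 0 < j) (hMj : 1 ≤ M * j) (hD : 0 ≤ D) (hB : 0 ≤ B)
    (hV : 0 ≤ V)
    (hy : |y| ≤ D) (hb : |b| ≤ B * j) (hP : |P| ≤ j ^ 2) (hNP : |NP| ≤ V * j) :
    |-(6 * b + 2 * y) * y * (r - b ^ 2) - 16 * P * y ^ 2 + 32 * P * y * b - 8 * NP * (r - b ^ 2)
      + 16 * NP * b ^ 2| ≤
      ((6 * B + 2 * D * M) * D + 8 * V) * (j * |r|) + (((6 * B + 2 * D * M) * D) * B ^ 2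
        + 16 * D * D * M + 32 * D * B + 24 * V * B ^ 2) * j ^ 3 := by
  have hyj : |y| ≤ D * M * j := by nlinarith
  have hb2 : |b ^ 2| ≤ B ^ 2 * j ^ 2 := by
    rw [abs_of_nonneg (sq_nonneg b), ← sq_abs]
    nlinarith [abs_nonneg b, mul_nonneg hB hj.le]
  have h1 : |-(6 * b + 2 * y)| ≤ (6 * B + 2 * D * M) * j := by
    rw [abs_neg]
    refine (abs_add_le _ _).trans ?_
    rw [abs_mul, abs_mul, abs_of_pos (by norm_num : (0 : ℝ) < 6),
      abs_of_pos (by norm_num : (0 : ℝ) < 2)]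
    nlinarith
  have h2 := abs_prod2 h1 hy
  have hr : |r - b ^ 2| ≤ |r| + B ^ 2 * j ^ 2 := (abs_sub _ _).trans (by linarith)
  have t1 := abs_prod2 h2 hr
  have t2 : |16 * P * y ^ 2| ≤ 16 * j ^ 2 * (D * (D * M * j)) := by
    have := abs_prod2 hP (abs_prod2 hy hyj)
    rw [show 16 * P * y ^ 2 = 16 * (P * (y * y)) by ring, abs_mul,
      abs_of_pos (by norm_num : (0 : ℝ) < 16)]
    linarith
  have t3 : |32 * P * y * b| ≤ 32 * j ^ 2 * (D * (B * j)) := by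
    have := abs_prod2 hP (abs_prod2 hy hb)
    rw [show 32 * P * y * b = 32 * (P * (y * b)) by ring, abs_mul,
      abs_of_pos (by norm_num : (0 : ℝ) < 32)]
    linarith
  have t4 : |8 * NP * (r - b ^ 2)| ≤ 8 * (V * j) * (|r| + B ^ 2 * j ^ 2) := by
    have := abs_prod2 hNP hr
    rw [show 8 * NP * (r - b ^ 2) = 8 * (NP * (r - b ^ 2)) by ring, abs_mul,
      abs_of_pos (by norm_num : (0 : ℝ) < 8)]
    linarith
  have t5 : |16 * NP * b ^ 2| ≤ 16 * (V * j) * (B ^ 2 * j ^ 2) := by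
    have := abs_prod2 hNP hb2
    rw [show 16 * NP * b ^ 2 = 16 * (NP * b ^ 2) by ring, abs_mul,
      abs_of_pos (by norm_num : (0 : ℝ) < 16)]
    linarith
  rw [abs_le] at t1 t2 t3 t4 t5 ⊢
  constructor <;> nlinarith

theorem young8 (x z c j : ℝ) : 2 * (x * (c * (j * z))) ≤ 2 * (j ^ 2 * x ^ 2) + c ^ 2 / 2 * z ^ 2 := by
  have := sq_nonneg (2 * (j * x) - c * z)
  linarith

theorem alg8w {w S r c3 c4 j N : ℝ} (hN : N = j ^ 2)
    (hS : |S| ≤ c3 * (j * |r|) + c4 * j ^ 3) :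
    2 * w * S ≤ 4 * N * w ^ 2 + c3 ^ 2 / 2 * r ^ 2 + c4 ^ 2 / 2 * N ^ 2 := by
  have e1 : w * S ≤ |w| * (c3 * (j * |r|) + c4 * j ^ 3) := by
    refine (le_abs_self _).trans ?_
    rw [abs_mul]
    exact mul_le_mul_of_nonneg_left hS (abs_nonneg _)
  have e2 := young8 |w| |r| c3 j
  have e3 := young8 |w| (j ^ 2) c4 j
  rw [sq_abs] at e2 e3
  rw [sq_abs] at e2
  rw [hN]
  linarith

theorem alg8p {b y r N P B : ℝ} (hP0 : 0 < P) (hPN : P ≤ N) (hb : b ^ 2 ≤ B * N)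
    (hB : 0 ≤ B) :
    -2 * r ^ 2 - 4 * b ^ 2 * r + 2 * b * (-((b + y) ^ 2 + b ^ 2) * b + 4 * (b + y) * P
      - 6 * b * P + 4 * b * N) ≤ -r ^ 2 + (2 * B ^ 2 + 8 + 8 * B) * N ^ 2 := by
  have hN0 : 0 < N := hP0.trans_le hPN
  have hb4 : b ^ 2 * b ^ 2 ≤ (B * N) * (B * N) :=
    mul_le_mul hb hb (sq_nonneg b) (by positivity)
  have hP2 : P * P ≤ N * N := mul_le_mul hPN hPN hP0.le hN0.le
  have hbN : b ^ 2 * N ≤ (B * N) * N := mul_le_mul_of_nonneg_right hb hN0.le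
  have h1 : 0 ≤ b ^ 2 * P := by positivity
  have h2 := sq_nonneg (r + 2 * b ^ 2)
  have h3 := sq_nonneg ((b + y) * b - 2 * P)
  have h4 : 0 ≤ B * N ^ 2 := by positivity
  nlinarith

set_option maxHeartbeats 1000000 in
theorem alg8 {a b a1 b1 a2 b2 a3 b3 N P Y K j B c3 c4 C : ℝ} (hY : 0 < Y) (hj : 0 < j)
    (hYN : Y * N = 1) (hN : N = j ^ 2) (hP0 : 0 < P) (hPN : P ≤ N) (hb : b ^ 2 ≤ B * N)
    (hB : 0 ≤ B)
    (hS : |-(6 * b + 2 * (a - b)) * (a - b) * (b1 + b ^ 2 - b ^ 2) - 16 * P * (a - b) ^ 2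
      + 32 * P * (a - b) * b - 8 * (N - P) * (b1 + b ^ 2 - b ^ 2)
      + 16 * (N - P) * b ^ 2| ≤ c3 * (j * |b1 + b ^ 2|) + c4 * j ^ 3)
    (hK : K = c3 ^ 2)
    (hC : c4 ^ 2 / 2 + K * (2 * B ^ 2 + 8 + 8 * B) ≤ 4 * (C - K * B))
    (hs : Y * (2 * b * ((a1 - b1) ^ 2 + K * b ^ 2)
      + (2 * (a1 - b1) * (a2 - b2) + 2 * K * b * b1)) = 0)
    (hss : Y * (2 * b * (2 * b * ((a1 - b1) ^ 2 + K * b ^ 2)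
        + (2 * (a1 - b1) * (a2 - b2) + 2 * K * b * b1))
      + (2 * b1 * ((a1 - b1) ^ 2 + K * b ^ 2) + 2 * b * (2 * (a1 - b1) * (a2 - b2) + 2 * K * b * b1)
        + (2 * (a2 - b2) ^ 2 + 2 * (a1 - b1) * (a3 - b3) + 2 * K * (b1 ^ 2 + b * b2)))) ≤ 0)
    (hQ : C < Y * ((a1 - b1) ^ 2 + K * b ^ 2)) :
    Y * (2 * (b1 + 2 * (b * b) + a * b + 2 * P - 4 * N) * ((a1 - b1) ^ 2 + K * b ^ 2)
      + (2 * (a1 - b1) * ((a3 + a1 ^ 2 + a * a2 + 2 * a2 * b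
    + 2 * a1 * b1 - 3 * a ^ 2 * a1 - 2 * a1 * b ^ 2
    - 4 * a * b * b1 - 4 * a1 * P
    - 4 * a * (2 * a - 4 * b) * P
    + 8 * b1 * P + 8 * b * (2 * a - 4 * b) * P
    - (a1 + a ^ 2 + 2 * b1 + 2 * b ^ 2) * a1) - (b3 + 2 * b1 ^ 2 + 2 * b * b2 + a1 * b1
    + a * b2 - 2 * a * a1 * b - a ^ 2 * b1 - 6 * b ^ 2 * b1
    + 4 * a1 * P + 4 * a * (2 * a - 4 * b) * P - 8 * b1 * P
    - 8 * b * (2 * a - 4 * b) * P + 8 * b1 * N - 16 * b ^ 2 * N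
    - (a1 + a ^ 2 + 2 * b1 + 2 * b ^ 2) * b1))
      + 2 * K * b * (b2 + 2 * b * b1 + a * b1 - a ^ 2 * b
    - 2 * b ^ 3 + 4 * a * P - 8 * b * P + 8 * b * N))) ≤ 0 := by
  have h1 := (mul_eq_zero.mp hs).resolve_left hY.ne'
  have h2 := nonpos_of_mul_nonpos_right hss hY
  refine mul_nonpos_of_nonneg_of_nonpos hY.le ?_
  have hK0 : 0 ≤ K := hK ▸ sq_nonneg c3
  have hN0 : 0 < N := hP0.trans_le hPN
  obtain ⟨y, rfl⟩ : ∃ y, a = b + y := ⟨a - b, by ring⟩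
  obtain ⟨w, rfl⟩ : ∃ w, a1 = b1 + w := ⟨a1 - b1, by ring⟩
  obtain ⟨w1, rfl⟩ : ∃ w1, a2 = b2 + w1 := ⟨a2 - b2, by ring⟩
  obtain ⟨w2, rfl⟩ : ∃ w2, a3 = b3 + w2 := ⟨a3 - b3, by ring⟩
  obtain ⟨r, rfl⟩ : ∃ r, b1 = r - b ^ 2 := ⟨b1 + b ^ 2, by ring⟩
  simp only [add_sub_cancel_left, sub_add_cancel] at *
  set S := -(6 * b + 2 * y) * y * (r - b ^ 2) - 16 * P * y ^ 2
      + 32 * P * y * b - 8 * (N - P) * (r - b ^ 2)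
      + 16 * (N - P) * b ^ 2 with hSdef
  -- size of w
  have hw : (C - K * B) * N < w ^ 2 := by
    have e1 : Y * (K * b ^ 2) ≤ K * B := by
      have := mul_le_mul_of_nonneg_left (mul_le_mul_of_nonneg_left hb hK0) hY.le
      rwa [show Y * (K * (B * N)) = K * B * (Y * N) by ring, hYN, mul_one] at this
    have e2 : C - K * B < Y * w ^ 2 := by linear_combination hQ + e1
    have := mul_lt_mul_of_pos_right e2 hN0
    rwa [show Y * w ^ 2 * N = w ^ 2 * (Y * N) by ring, hYN, mul_one] at this
  have hwS := alg8w (w := w) hN hS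
  have part2' := mul_le_mul_of_nonneg_left (alg8p (r := r) (y := y) hP0 hPN hb hB) hK0
  have hfin : (c4 ^ 2 / 2 + K * (2 * B ^ 2 + 8 + 8 * B)) * N ^ 2 ≤ 4 * N * w ^ 2 := by
    have e1 := mul_le_mul_of_nonneg_right hC (sq_nonneg N)
    have e2 := mul_le_mul_of_nonneg_left hw.le (by positivity : 0 ≤ 4 * N)
    linear_combination e1 + e2
  have hr0 : 0 ≤ c3 ^ 2 * r ^ 2 := by positivity
  have part1 : w ^ 2 * (-8 * y ^ 2 - 12 * b * y - 8 * b ^ 2 - 8 * N - 12 * P) ≤ -8 * N * w ^ 2 := by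
    have e : 0 ≤ w ^ 2 * (8 * y ^ 2 + 12 * b * y + 8 * b ^ 2) := by
      apply mul_nonneg (sq_nonneg w)
      nlinarith [sq_nonneg (b + y), sq_nonneg b, sq_nonneg y]
    have e2 : 0 ≤ w ^ 2 * P := by positivity
    linear_combination e + 12 * e2
  have main := add_nonneg (sq_nonneg (w1 + 2 * b * w)) (sq_nonneg (w1 + 2 * b * w))
  have h1' : (y + 3 * b) * (2 * b * (w ^ 2 + K * b ^ 2) + (2 * w * w1 + 2 * K * b * (r - b ^ 2)))
    = 0 := by rw [h1, mul_zero]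
  have total : w ^ 2 * (-8 * y ^ 2 - 12 * b * y - 8 * b ^ 2 - 8 * N - 12 * P) + 2 * w * S
    + K * (-2 * r ^ 2 - 4 * b ^ 2 * r + 2 * b * (-((b + y) ^ 2 + b ^ 2) * b + 4 * (b + y) * P
      - 6 * b * P + 4 * b * N)) ≤ 0 := by
    linear_combination part1 + hwS + part2' + hfin + hr0 / 2 - r ^ 2 * hK
  rw [hSdef] at total
  linear_combination total + h2 + h1' + main

theorem algR {a b a1 b1 a2 b2 a3 b3 N P : ℝ}
    (hs : a2 + 2 * b2 + 2 * a * a1 + 2 * (a1 * b + a * b1) + 6 * b * b1 + 8 * b * N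
      + (2 * a - 4 * b) * P = 0)
    (hss : a3 + 2 * b3 + 2 * (a1 ^ 2 + a * a2) + 2 * (a2 * b + 2 * a1 * b1 + a * b2)
      + 6 * (b1 ^ 2 + b * b2) + 8 * (b1 * N - 2 * b ^ 2 * N)
      + ((2 * a1 - 4 * b1) * P + (2 * a - 4 * b) ^ 2 * P) ≤ 0) :
    (a3 + a1 ^ 2 + a * a2 + 2 * a2 * b
    + 2 * a1 * b1 - 3 * a ^ 2 * a1 - 2 * a1 * b ^ 2
    - 4 * a * b * b1 - 4 * a1 * P
    - 4 * a * (2 * a - 4 * b) * P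
    + 8 * b1 * P + 8 * b * (2 * a - 4 * b) * P
    - (a1 + a ^ 2 + 2 * b1 + 2 * b ^ 2) * a1) + 2 * (b3 + 2 * b1 ^ 2 + 2 * b * b2 + a1 * b1
    + a * b2 - 2 * a * a1 * b - a ^ 2 * b1 - 6 * b ^ 2 * b1
    + 4 * a1 * P + 4 * a * (2 * a - 4 * b) * P - 8 * b1 * P
    - 8 * b * (2 * a - 4 * b) * P + 8 * b1 * N - 16 * b ^ 2 * N
    - (a1 + a ^ 2 + 2 * b1 + 2 * b ^ 2) * b1)
    + 2 * (a + b) * (a2 + a * a1 + 2 * a1 * b - a ^ 3 - 2 * a * b ^ 2 - 4 * a * P + 8 * b * P)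
    + (2 * a + 6 * b) * (b2 + 2 * b * b1 + a * b1 - a ^ 2 * b
    - 2 * b ^ 3 + 4 * a * P - 8 * b * P + 8 * b * N)
    + 8 * (b1 + 2 * (b * b) + a * b + 2 * P - 4 * N) * N
    + (2 * (a1 + a * a + 2 * (a * b) - 2 * P)
    - 4 * (b1 + 2 * (b * b) + a * b + 2 * P - 4 * N)) * P ≤ 0 := by
  have h1 : (a + 2 * b) * (a2 + 2 * b2 + 2 * a * a1 + 2 * (a1 * b + a * b1) + 6 * b * b1
      + 8 * b * N + (2 * a - 4 * b) * P) = 0 := by rw [hs, mul_zero]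
  have q1 := sq_nonneg (-(a1 + a ^ 2) + 2 * -(b1 + b ^ 2))
  have q2 := sq_nonneg (-(a1 + a ^ 2) + 2 * (P - a * b))
  have q3 := sq_nonneg (-(b1 + b ^ 2) + (P - a * b) + (4 * N - 3 * P - b ^ 2))
  linear_combination hss + h1 + q1 + q2 + 2 * q3

/-! ### Calculus helpers -/

theorem D1.cg {T : ℝ} {ρ p q q' : ℝ → ℝ → ℝ} (h : D1 T ρ p q) (e : ∀ x t, q' x t = q x t) :
    D1 T ρ p q' := by
  have : q' = q := by funext x t; exact e x t
  rw [this]; exact h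

theorem Dt.cg {T : ℝ} {p q q' : ℝ → ℝ → ℝ} (h : Dt T p q) (e : ∀ x t, q' x t = q x t) :
    Dt T p q' := by
  have : q' = q := by funext x t; exact e x t
  rw [this]; exact h

theorem D1.add {T : ℝ} {ρ p q p' q' : ℝ → ℝ → ℝ} (h : D1 T ρ p p') (k : D1 T ρ q q') :
    D1 T ρ (fun x t => p x t + q x t) (fun x t => p' x t + q' x t) := by
  intro x t h0 hT
  refine ((h x t h0 hT).add (k x t h0 hT)).congr_deriv ?_
  ring

theorem D1.sub {T : ℝ} {ρ p q p' q' : ℝ → ℝ → ℝ} (h : D1 T ρ p p') (k : D1 T ρ q q') :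
    D1 T ρ (fun x t => p x t - q x t) (fun x t => p' x t - q' x t) := by
  intro x t h0 hT
  refine ((h x t h0 hT).sub (k x t h0 hT)).congr_deriv ?_
  ring

theorem D1.mul {T : ℝ} {ρ p q p' q' : ℝ → ℝ → ℝ} (h : D1 T ρ p p') (k : D1 T ρ q q') :
    D1 T ρ (fun x t => p x t * q x t) (fun x t => p' x t * q x t + p x t * q' x t) := by
  intro x t h0 hT
  refine ((h x t h0 hT).mul (k x t h0 hT)).congr_deriv ?_
  ring

theorem D1.cm {T : ℝ} {ρ p p' : ℝ → ℝ → ℝ} (c : ℝ) (h : D1 T ρ p p') :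
    D1 T ρ (fun x t => c * p x t) (fun x t => c * p' x t) := by
  intro x t h0 hT
  refine ((h x t h0 hT).const_mul c).congr_deriv ?_
  ring

theorem D1.ex {T : ℝ} {ρ p p' : ℝ → ℝ → ℝ} (c : ℝ) (h : D1 T ρ p p') :
    D1 T ρ (fun x t => Real.exp (c * p x t)) (fun x t => c * p' x t * Real.exp (c * p x t)) := by
  intro x t h0 hT
  refine (((h x t h0 hT).const_mul c).exp).congr_deriv ?_
  ring

theorem Dt.add {T : ℝ} {p q p' q' : ℝ → ℝ → ℝ} (h : Dt T p p') (k : Dt T q q') :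
    Dt T (fun x t => p x t + q x t) (fun x t => p' x t + q' x t) :=
  fun x t h0 hT => (h x t h0 hT).add (k x t h0 hT)

theorem Dt.sub {T : ℝ} {p q p' q' : ℝ → ℝ → ℝ} (h : Dt T p p') (k : Dt T q q') :
    Dt T (fun x t => p x t - q x t) (fun x t => p' x t - q' x t) :=
  fun x t h0 hT => (h x t h0 hT).sub (k x t h0 hT)

theorem Dt.mul {T : ℝ} {p q p' q' : ℝ → ℝ → ℝ} (h : Dt T p p') (k : Dt T q q') :
    Dt T (fun x t => p x t * q x t) (fun x t => p' x t * q x t + p x t * q' x t) :=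
  fun x t h0 hT => (h x t h0 hT).mul (k x t h0 hT)

theorem Dt.cm {T : ℝ} {p p' : ℝ → ℝ → ℝ} (c : ℝ) (h : Dt T p p') :
    Dt T (fun x t => c * p x t) (fun x t => c * p' x t) :=
  fun x t h0 hT => (h x t h0 hT).const_mul c

theorem Dt.ex {T : ℝ} {p p' : ℝ → ℝ → ℝ} (c : ℝ) (h : Dt T p p') :
    Dt T (fun x t => Real.exp (c * p x t)) (fun x t => c * p' x t * Real.exp (c * p x t)) := by
  intro x t h0 hT
  refine (((h x t h0 hT).const_mul c).exp).congr_deriv ?_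
  ring

/-! ### A priori estimates -/

section estimates

variable {T : ℝ} {ρ F G a b a1 b1 a2 b2 a3 b3 N P : ℝ → ℝ → ℝ}

theorem BFlow.E1 (h : BFlow T ρ F G a b a1 b1 a2 b2 a3 b3 N P) (hi : ∀ x, F x 0 ≤ G x 0) :
    ∀ x t, 0 ≤ t → t < T → F x t ≤ G x t := by
  have := MP h.rpos (h.sF.cont.sub h.sG.cont)
    (fun x t => by rw [h.pF, h.pG]) (h.dF.sub h.dG) (h.da.sub h.db) (h.tF.sub h.tG) 0
    (fun x => by linarith [hi x]) (fun x t h0 hT hs hss hQ => by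
      have e : a x t = b x t := by linarith
      have hNP : N x t ≤ P x t := by
        rw [h.eN, h.eP, Real.exp_le_exp]; linarith
      rw [e]; nlinarith)
  intro x t h0 hT
  linarith [this x t h0 hT]

theorem BFlow.PN (h : BFlow T ρ F G a b a1 b1 a2 b2 a3 b3 N P) {x t : ℝ} (hi : F x t ≤ G x t) :
    P x t ≤ N x t := by
  rw [h.eN, h.eP, Real.exp_le_exp]; linarith

theorem BFlow.E2 (h : BFlow T ρ F G a b a1 b1 a2 b2 a3 b3 N P)
    (h1 : ∀ x t, 0 ≤ t → t < T → F x t ≤ G x t) {c : ℝ} (hi : ∀ x, G x 0 + c ≤ F x 0) :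
    ∀ x t, 0 ≤ t → t < T → G x t + c ≤ F x t := by
  have := MP h.rpos (h.sG.cont.sub h.sF.cont)
    (fun x t => by rw [h.pF, h.pG]) (h.dG.sub h.dF) (h.db.sub h.da) (h.tG.sub h.tF) (-c)
    (fun x => by linarith [hi x]) (fun x t h0 hT hs hss hQ => by
      have e : a x t = b x t := by linarith
      have hNP := h.PN (h1 x t h0.le hT)
      rw [e]; nlinarith)
  intro x t h0 hT
  linarith [this x t h0 hT]

theorem BFlow.E3 (h : BFlow T ρ F G a b a1 b1 a2 b2 a3 b3 N P)
    (h1 : ∀ x t, 0 ≤ t → t < T → F x t ≤ G x t) :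
    ∃ C, ∀ x t, 0 ≤ t → t < T → G x t ≤ C := by
  obtain ⟨C, -, hC⟩ := init_bdd h.Tpos h.sG.cont h.pG
  refine ⟨C, MP h.rpos h.sG.cont h.pG h.dG h.db h.tG C hC (fun x t h0 hT hs hss hQ => ?_)⟩
  have hNP := h.PN (h1 x t h0.le hT)
  have hN : 0 < N x t := by rw [h.eN]; exact Real.exp_pos _
  rw [hs]; nlinarith

theorem BFlow.E4 (h : BFlow T ρ F G a b a1 b1 a2 b2 a3 b3 N P)
    (h1 : ∀ x t, 0 ≤ t → t < T → F x t ≤ G x t)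
    (hi : ∀ x, Real.exp (2 * F x 0) * (a x 0 * a x 0) ≤ 4 / 3) :
    ∀ x t, 0 ≤ t → t < T → Real.exp (2 * F x t) * (a x t * a x t) ≤ 4 / 3 := by
  refine MP h.rpos ((Real.continuous_exp.comp_continuousOn (continuousOn_const.mul h.sF.cont)).mul
      (h.sa.cont.mul h.sa.cont))
    (fun x t => by rw [h.pF, h.pa])
    (Qs := fun x t => Real.exp (2 * F x t) * (2 * (a x t * (a1 x t + a x t * a x t))))
    (((h.dF.ex 2).mul (h.da.mul h.da)).cg (fun x t => by ring))
    ((h.dF.ex 2).mul ((h.da.mul (h.da1.add (h.da.mul h.da))).cm 2))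
    ((h.tF.ex 2).mul (h.ta.mul h.ta)) (4 / 3) hi (fun x t h0 hT hs hss hQ => ?_)
  have hX := Real.exp_pos (2 * F x t)
  have hP : 0 < P x t := by rw [h.eP]; exact Real.exp_pos _
  have hXP : Real.exp (2 * F x t) * P x t ≤ 1 := by
    rw [h.eP, ← Real.exp_add, Real.exp_le_one_iff]
    linarith [h1 x t h0.le hT]
  have := alg4 (b := b x t) (a := a x t) (a1 := a1 x t) (a2 := a2 x t) hX hP hXP
    (by rw [← hs]; ring) (le_trans (le_of_eq (by ring)) hss) hQ
  refine le_trans (le_of_eq ?_) this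
  ring

theorem BFlow.E5 (h : BFlow T ρ F G a b a1 b1 a2 b2 a3 b3 N P)
    (h1 : ∀ x t, 0 ≤ t → t < T → F x t ≤ G x t) :
    ∃ C, 0 < C ∧ ∀ x t, 0 ≤ t → t < T → Real.exp (2 * G x t) * (b x t * b x t) ≤ C := by
  have hc := ((Real.continuous_exp.comp_continuousOn
    (continuousOn_const (c := (2 : ℝ)).mul h.sG.cont)).mul (h.sb.cont.mul h.sb.cont))
  have hper : ∀ x t, Real.exp (2 * G (x + 2 * π) t) * (b (x + 2 * π) t * b (x + 2 * π) t)
      = Real.exp (2 * G x t) * (b x t * b x t) := fun x t => by rw [h.pG, h.pb]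
  obtain ⟨C, -, hC⟩ := init_bdd (Q := fun x t => Real.exp (2 * G x t) * (b x t * b x t))
    h.Tpos hc hper
  refine ⟨max C 5, by positivity, MP h.rpos hc hper
    (Qs := fun x t => Real.exp (2 * G x t) * (2 * (b x t * (b1 x t + b x t * b x t))))
    (((h.dG.ex 2).mul (h.db.mul h.db)).cg (fun x t => by ring))
    ((h.dG.ex 2).mul ((h.db.mul (h.db1.add (h.db.mul h.db))).cm 2))
    ((h.tG.ex 2).mul (h.tb.mul h.tb)) _ (fun x => (hC x).trans (le_max_left _ _))
    (fun x t h0 hT hs hss hQ => ?_)⟩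
  have hX := Real.exp_pos (2 * G x t)
  have hP : 0 < P x t := by rw [h.eP]; exact Real.exp_pos _
  have hYN : Real.exp (2 * G x t) * N x t = 1 := by
    rw [h.eN, ← Real.exp_add, Real.exp_eq_one_iff]
    ring
  have := alg5 (b := b x t) (a := a x t) (b1 := b1 x t) (b2 := b2 x t) hX hP
    (h.PN (h1 x t h0.le hT)) hYN
    (by rw [← hs]; ring) (le_trans (le_of_eq (by ring)) hss) ((le_max_right _ _).trans_lt hQ)
  refine le_trans (le_of_eq ?_) this
  ring

theorem BFlow.ij (h : BFlow T ρ F G a b a1 b1 a2 b2 a3 b3 N P) (x t : ℝ) :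
    N x t = Real.exp (-1 * G x t) ^ 2 ∧
    P x t * Real.exp (-1 * F x t) ^ 2 = Real.exp (-1 * G x t) ^ 4 ∧
    Real.exp (2 * F x t) * Real.exp (-1 * F x t) ^ 2 = 1 ∧
    Real.exp (2 * G x t) * Real.exp (-1 * G x t) ^ 2 = 1 := by
  rw [h.eN, h.eP]
  simp only [← Real.exp_nat_mul, ← Real.exp_add, Real.exp_eq_one_iff, Real.exp_eq_exp]
  push_cast
  refine ⟨by ring, by ring, by ring, by ring⟩

theorem BFlow.E6 (h : BFlow T ρ F G a b a1 b1 a2 b2 a3 b3 N P)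
    (h1 : ∀ x t, 0 ≤ t → t < T → F x t ≤ G x t) {x : ℝ} (hx : 0 < x)
    (hx2 : 4 / 3 < 2 * x ^ 5 + 4 * x ^ 4)
    (h2 : ∀ y t, 0 ≤ t → t < T → x * Real.exp (-1 * F y t) ≤ Real.exp (-1 * G y t))
    (h4 : ∀ x t, 0 ≤ t → t < T → Real.exp (2 * F x t) * (a x t * a x t) ≤ 4 / 3) :
    ∃ C, 0 < C ∧ ∀ x t, 0 ≤ t → t < T → Real.exp (-1 * F x t) - Real.exp (-1 * G x t) ≤ C := by
  have hc := ((Real.continuous_exp.comp_continuousOn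
    (continuousOn_const (c := (-1 : ℝ)).mul h.sF.cont)).sub (Real.continuous_exp.comp_continuousOn
    (continuousOn_const (c := (-1 : ℝ)).mul h.sG.cont)))
  have hper : ∀ x t, Real.exp (-1 * F (x + 2 * π) t) - Real.exp (-1 * G (x + 2 * π) t)
      = Real.exp (-1 * F x t) - Real.exp (-1 * G x t) := fun x t => by rw [h.pG, h.pF]
  obtain ⟨C, hC0, hC⟩ := init_bdd (Q := fun x t => Real.exp (-1 * F x t) - Real.exp (-1 * G x t))
    h.Tpos hc hper
  refine ⟨C, hC0, MP h.rpos hc hper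
    ((h.dF.ex (-1)).sub (h.dG.ex (-1)))
    (((h.da.cm (-1)).mul (h.dF.ex (-1))).sub ((h.db.cm (-1)).mul (h.dG.ex (-1))))
    ((h.tF.ex (-1)).sub (h.tG.ex (-1))) _ hC
    (fun y t h0 hT hs hss hQ => ?_)⟩
  obtain ⟨e1, e2, e3, e4⟩ := h.ij y t
  have hi := Real.exp_pos (-1 * F y t)
  have ha : a y t ^ 2 ≤ 4 / 3 * Real.exp (-1 * F y t) ^ 2 := by
    have := mul_le_mul_of_nonneg_right (h4 y t h0.le hT) (sq_nonneg (Real.exp (-1 * F y t)))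
    linear_combination this - a y t ^ 2 * e3
  have := alg6 (b := b y t) (a := a y t) (a1 := a1 y t) (b1 := b1 y t) hi
    (by rw [Real.exp_le_exp]; linarith [h1 y t h0.le hT]) hx (h2 y t h0.le hT) hx2 e1 e2 ha
    (by rw [← hs]; ring) (le_trans (le_of_eq (by ring)) hss)
  refine le_trans (le_of_eq ?_) this
  ring

end estimates

theorem algNP {i j N P C x b B : ℝ} (hi : 0 < i) (hj : 0 < j) (hji : j ≤ i) (hx : 0 < x)
    (hxj : x * i ≤ j) (hN : N = j ^ 2) (hP : P * i ^ 2 = j ^ 4) (hC : 0 < C) (h6 : i - j ≤ C)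
    (hb : |b| ≤ B * j) (hB : 0 ≤ B) :
    0 ≤ N - P ∧ N - P ≤ 2 * C * j ∧ |(N - P) * b| ≤ (2 * C * B / x) * P := by
  have hi2 : 0 < i ^ 2 := by positivity
  have e : (N - P) * i ^ 2 = j ^ 2 * ((i - j) * (i + j)) := by
    rw [sub_mul, hP, hN]; ring
  have h0 : 0 ≤ N - P := by
    have : 0 ≤ (N - P) * i ^ 2 := by
      rw [e]
      exact mul_nonneg (sq_nonneg j) (mul_nonneg (by linarith) (by linarith))
    exact nonneg_of_mul_nonneg_left this hi2
  have h1 : (i - j) * (i + j) ≤ C * (2 * i) :=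
    mul_le_mul h6 (by linarith) (by linarith) hC.le
  have h2 : (N - P) * i ^ 2 ≤ j ^ 2 * (C * (2 * i)) := by
    rw [e]; exact mul_le_mul_of_nonneg_left h1 (sq_nonneg j)
  refine ⟨h0, ?_, ?_⟩
  · refine le_of_mul_le_mul_right (h2.trans ?_) hi2
    have := mul_le_mul_of_nonneg_left hji (by positivity : 0 ≤ 2 * C * j * i)
    linear_combination this
  · rw [abs_mul, abs_of_nonneg h0]
    refine le_of_mul_le_mul_right ?_ hi2
    have h3 : (N - P) * i ^ 2 * |b| ≤ j ^ 2 * (C * (2 * i)) * (B * j) :=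
      mul_le_mul h2 hb (abs_nonneg _) (by positivity)
    have h4 : i ≤ j / x := by rw [le_div_iff₀ hx]; linarith
    have h5 := mul_le_mul_of_nonneg_left h4 (by positivity : 0 ≤ 2 * C * B * j ^ 3)
    rw [mul_assoc (2 * C * B / x), hP]
    have h7 : 2 * C * B / x * j ^ 4 = 2 * C * B * j ^ 3 * (j / x) := by
      field_simp
    rw [h7]
    linear_combination h3 + h5

section estimates2

variable {T : ℝ} {ρ F G a b a1 b1 a2 b2 a3 b3 N P : ℝ → ℝ → ℝ}

theorem BFlow.bb (h : BFlow T ρ F G a b a1 b1 a2 b2 a3 b3 N P) {C x t : ℝ}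
    (hb : Real.exp (2 * G x t) * (b x t * b x t) ≤ C) :
    b x t ^ 2 ≤ C * N x t ∧ |b x t| ≤ √C * Real.exp (-1 * G x t) := by
  obtain ⟨e1, e2, e3, e4⟩ := h.ij x t
  have h1 : b x t ^ 2 ≤ C * Real.exp (-1 * G x t) ^ 2 := by
    have := mul_le_mul_of_nonneg_right hb (sq_nonneg (Real.exp (-1 * G x t)))
    linear_combination this - b x t ^ 2 * e4
  refine ⟨by rw [e1]; exact h1, ?_⟩
  have h2 := Real.abs_le_sqrt h1
  rwa [Real.sqrt_mul' _ (sq_nonneg _), Real.sqrt_sq (Real.exp_pos _).le] at h2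

theorem BFlow.E7 (h : BFlow T ρ F G a b a1 b1 a2 b2 a3 b3 N P)
    {D : ℝ} (hD : 0 ≤ D)
    (hb : ∀ x t, 0 ≤ t → t < T → |(N x t - P x t) * b x t| ≤ D * P x t) :
    ∃ C, 0 ≤ C ∧ ∀ x t, 0 ≤ t → t < T → |a x t - b x t| ≤ C := by
  have hc := (h.sa.cont.sub h.sb.cont).mul (h.sa.cont.sub h.sb.cont)
  have hper : ∀ x t, (a (x + 2 * π) t - b (x + 2 * π) t) * (a (x + 2 * π) t - b (x + 2 * π) t)
      = (a x t - b x t) * (a x t - b x t) := fun x t => by rw [h.pa, h.pb]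
  obtain ⟨C, hC0, hC⟩ := init_bdd (Q := fun x t => (a x t - b x t) * (a x t - b x t))
    h.Tpos hc hper
  refine ⟨√(max C (D ^ 2)), Real.sqrt_nonneg _, fun x t h0 hT => Real.abs_le_sqrt ?_⟩
  rw [pow_two]
  revert x t
  refine MP h.rpos hc hper
    (Qs := fun x t => 2 * ((a x t - b x t) * (a1 x t - b1 x t)))
    (((h.da.sub h.db).mul (h.da.sub h.db)).cg (fun x t => by ring))
    (((h.da.sub h.db).mul (h.da1.sub h.db1)).cm 2)
    ((h.ta.sub h.tb).mul (h.ta.sub h.tb)) _ (fun x => (hC x).trans (le_max_left _ _))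
    (fun x t h0 hT hs hss hQ => ?_)
  have hP : 0 < P x t := by rw [h.eP]; exact Real.exp_pos _
  have := alg7 (b := b x t) (a := a x t) (b1 := b1 x t) (b2 := b2 x t)
    (a1 := a1 x t) (a2 := a2 x t) hP hD (hb x t h0.le hT)
    (by rw [← hs]; ring) (le_trans (le_of_eq (by ring)) hss) ((le_max_right _ _).trans_lt hQ)
  refine le_trans (le_of_eq ?_) this
  ring

theorem BFlow.E8 (h : BFlow T ρ F G a b a1 b1 a2 b2 a3 b3 N P) {B D V C3 : ℝ}
    (h1 : ∀ x t, 0 ≤ t → t < T → F x t ≤ G x t)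
    (h3 : ∀ x t, 0 ≤ t → t < T → G x t ≤ C3) (hB : 0 < B)
    (h5 : ∀ x t, 0 ≤ t → t < T → Real.exp (2 * G x t) * (b x t * b x t) ≤ B)
    (hD : 0 ≤ D) (h7 : ∀ x t, 0 ≤ t → t < T → |a x t - b x t| ≤ D) (hV : 0 ≤ V)
    (hNP : ∀ x t, 0 ≤ t → t < T → |N x t - P x t| ≤ V * Real.exp (-1 * G x t)) :
    ∃ C, 0 ≤ C ∧ ∀ x t, 0 ≤ t → t < T → Real.exp (G x t) * |a1 x t - b1 x t| ≤ C := by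
  obtain ⟨M, hM⟩ : ∃ M, M = Real.exp C3 := ⟨_, rfl⟩
  obtain ⟨c3, hc3⟩ : ∃ c3, c3 = (6 * √B + 2 * D * M) * D + 8 * V := ⟨_, rfl⟩
  obtain ⟨c4, hc4⟩ : ∃ c4, c4 = (((6 * √B + 2 * D * M) * D) * √B ^ 2
        + 16 * D * D * M + 32 * D * √B + 24 * V * √B ^ 2) := ⟨_, rfl⟩
  obtain ⟨K, hK⟩ : ∃ K, K = c3 ^ 2 := ⟨_, rfl⟩
  have hc : ContinuousOn (fun p : ℝ × ℝ => Real.exp (2 * G p.1 p.2) *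
      ((a1 p.1 p.2 - b1 p.1 p.2) * (a1 p.1 p.2 - b1 p.1 p.2) + K * (b p.1 p.2 * b p.1 p.2)))
      (Set.univ ×ˢ Set.Ico 0 T) :=
    (Real.continuous_exp.comp_continuousOn
      (continuousOn_const (c := (2 : ℝ)).mul h.sG.cont)).mul
    (((h.sa1.cont.sub h.sb1.cont).mul (h.sa1.cont.sub h.sb1.cont)).add
      (continuousOn_const.mul (h.sb.cont.mul h.sb.cont)))
  have hper : ∀ x t, Real.exp (2 * G (x + 2 * π) t) *
      ((a1 (x + 2 * π) t - b1 (x + 2 * π) t) * (a1 (x + 2 * π) t - b1 (x + 2 * π) t)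
        + K * (b (x + 2 * π) t * b (x + 2 * π) t)) = Real.exp (2 * G x t) *
      ((a1 x t - b1 x t) * (a1 x t - b1 x t) + K * (b x t * b x t)) :=
    fun x t => by rw [h.pG, h.pb, h.pa1, h.pb1]
  obtain ⟨C, hC0, hC⟩ := init_bdd (Q := fun x t => Real.exp (2 * G x t) *
      ((a1 x t - b1 x t) * (a1 x t - b1 x t) + K * (b x t * b x t)))
    h.Tpos hc hper
  obtain ⟨C', hC'⟩ : ∃ C', C' = max C ((c4 ^ 2 / 2 + K * (2 * B ^ 2 + 8 + 8 * B)) / 4 + K * B) :=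
    ⟨_, rfl⟩
  have hCC : C ≤ C' := hC' ▸ le_max_left _ _
  have hCK : (c4 ^ 2 / 2 + K * (2 * B ^ 2 + 8 + 8 * B)) / 4 + K * B ≤ C' := hC' ▸ le_max_right _ _
  have key : ∀ x t, 0 ≤ t → t < T → Real.exp (2 * G x t) *
      ((a1 x t - b1 x t) * (a1 x t - b1 x t) + K * (b x t * b x t)) ≤ C' := by
    refine MP h.rpos hc hper
      (Qs := fun x t => Real.exp (2 * G x t) *
        (2 * (b x t * ((a1 x t - b1 x t) * (a1 x t - b1 x t) + K * (b x t * b x t)))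
        + (2 * ((a1 x t - b1 x t) * (a2 x t - b2 x t)) + 2 * K * (b x t * b1 x t))))
      (((h.dG.ex 2).mul (((h.da1.sub h.db1).mul (h.da1.sub h.db1)).add
        ((h.db.mul h.db).cm K))).cg (fun x t => by ring))
      ((h.dG.ex 2).mul (((h.db.mul (((h.da1.sub h.db1).mul (h.da1.sub h.db1)).add
        ((h.db.mul h.db).cm K))).cm 2).add ((((h.da1.sub h.db1).mul (h.da2.sub h.db2)).cm 2).add
          ((h.db.mul h.db1).cm (2 * K)))))
      ((h.tG.ex 2).mul (((h.ta1.sub h.tb1).mul (h.ta1.sub h.tb1)).add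
        ((h.tb.mul h.tb).cm K))) _ (fun x => (hC x).trans hCC)
      (fun x t h0 hT hs hss hQ => ?_)
    obtain ⟨e1, e2, e3, e4⟩ := h.ij x t
    have hj := Real.exp_pos (-1 * G x t)
    have hY := Real.exp_pos (2 * G x t)
    have hP : 0 < P x t := by rw [h.eP]; exact Real.exp_pos _
    have hPN := h.PN (h1 x t h0.le hT)
    obtain ⟨hb1, hb2⟩ := h.bb (h5 x t h0.le hT)
    have hMj : 1 ≤ M * Real.exp (-1 * G x t) := by
      rw [hM, ← Real.exp_add, Real.one_le_exp_iff]; linarith [h3 x t h0.le hT]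
    have hS := alg8S (r := b1 x t + b x t ^ 2) hj hMj hD (Real.sqrt_nonneg B) hV (h7 x t h0.le hT)
      hb2 (by rw [abs_of_pos hP, ← e1]; exact hPN : |P x t| ≤ _) (hNP x t h0.le hT)
    rw [← hc3, ← hc4] at hS
    have := alg8 (a2 := a2 x t) (b2 := b2 x t) (a1 := a1 x t) (a3 := a3 x t) (b3 := b3 x t)
      (C := C') hY hj (by rw [e1]; exact e4) e1 hP hPN hb1 hB.le hS hK (by linarith)
      (by rw [← hs]; ring) (le_trans (le_of_eq (by ring)) hss)
      (lt_of_lt_of_eq hQ (by ring))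
    refine le_trans (le_of_eq ?_) this
    ring
  refine ⟨√C', Real.sqrt_nonneg _, fun x t h0 hT => ?_⟩
  rw [← abs_of_pos (Real.exp_pos (G x t)), ← abs_mul]
  apply Real.abs_le_sqrt
  have h8 := key x t h0 hT
  have h9 : 0 ≤ Real.exp (2 * G x t) * (K * (b x t * b x t)) :=
    mul_nonneg (Real.exp_pos _).le (mul_nonneg (hK ▸ sq_nonneg c3) (mul_self_nonneg _))
  have h10 : Real.exp (2 * G x t) = Real.exp (G x t) ^ 2 := by
    rw [← Real.exp_nat_mul]; norm_num
  rw [h10] at h8 h9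
  linarith

theorem BFlow.ER (h : BFlow T ρ F G a b a1 b1 a2 b2 a3 b3 N P) :
    ∃ C, 0 < C ∧ ∀ x t, 0 ≤ t → t < T → a1 x t + 2 * b1 x t + (a x t * a x t + 2 * (a x t * b x t)
      + 3 * (b x t * b x t)) - (4 * N x t - P x t) ≤ C := by
  have eN : N = fun x t => Real.exp (-2 * G x t) := by funext x t; exact h.eN x t
  have eP : P = fun x t => Real.exp (2 * F x t - 4 * G x t) := by funext x t; exact h.eP x t
  have cN : ContinuousOn (fun p : ℝ × ℝ => N p.1 p.2) (Set.univ ×ˢ Set.Ico 0 T) := by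
    rw [eN]
    exact Real.continuous_exp.comp_continuousOn (continuousOn_const.mul h.sG.cont)
  have cP : ContinuousOn (fun p : ℝ × ℝ => P p.1 p.2) (Set.univ ×ˢ Set.Ico 0 T) := by
    rw [eP]
    exact Real.continuous_exp.comp_continuousOn ((continuousOn_const.mul h.sF.cont).sub
      (continuousOn_const.mul h.sG.cont))
  have hper : ∀ x t, a1 (x + 2 * π) t + 2 * b1 (x + 2 * π) t
      + (a (x + 2 * π) t * a (x + 2 * π) t + 2 * (a (x + 2 * π) t * b (x + 2 * π) t)
      + 3 * (b (x + 2 * π) t * b (x + 2 * π) t)) - (4 * N (x + 2 * π) t - P (x + 2 * π) t)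
      = a1 x t + 2 * b1 x t + (a x t * a x t + 2 * (a x t * b x t)
      + 3 * (b x t * b x t)) - (4 * N x t - P x t) :=
    fun x t => by rw [h.pb, h.pa, h.pa1, h.pb1, h.eN, h.eP, h.pF, h.pG, ← h.eN, ← h.eP]
  have hc : ContinuousOn (fun p : ℝ × ℝ => a1 p.1 p.2 + 2 * b1 p.1 p.2
      + (a p.1 p.2 * a p.1 p.2 + 2 * (a p.1 p.2 * b p.1 p.2)
      + 3 * (b p.1 p.2 * b p.1 p.2)) - (4 * N p.1 p.2 - P p.1 p.2))
      (Set.univ ×ˢ Set.Ico 0 T) :=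
    ((h.sa1.cont.add (continuousOn_const.mul h.sb1.cont)).add
      (((h.sa.cont.mul h.sa.cont).add (continuousOn_const.mul (h.sa.cont.mul h.sb.cont))).add
        (continuousOn_const.mul (h.sb.cont.mul h.sb.cont)))).sub
      ((continuousOn_const.mul cN).sub cP)
  obtain ⟨C, hC0, hC⟩ := init_bdd (Q := fun x t => a1 x t + 2 * b1 x t
      + (a x t * a x t + 2 * (a x t * b x t)
      + 3 * (b x t * b x t)) - (4 * N x t - P x t)) h.Tpos hc hper
  refine ⟨C, hC0, MP h.rpos hc hper
    (Qs := fun x t => a2 x t + 2 * b2 x t + (2 * (a x t * a1 x t)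
      + 2 * (a1 x t * b x t + a x t * b1 x t) + 6 * (b x t * b1 x t))
      + (8 * (b x t * N x t) + (2 * a x t - 4 * b x t) * P x t))
    (((h.da1.add (h.db1.cm 2)).add (((h.da.mul h.da).add ((h.da.mul h.db).cm 2)).add
      ((h.db.mul h.db).cm 3))).sub ((h.dN.cm 4).sub h.dP) |>.cg (fun x t => by ring))
    (((h.da2.add (h.db2.cm 2)).add ((((h.da.mul h.da1).cm 2).add
      (((h.da1.mul h.db).add (h.da.mul h.db1)).cm 2)).add ((h.db.mul h.db1).cm 6))).add
      (((h.db.mul h.dN).cm 8).add (((h.da.cm 2).sub (h.db.cm 4)).mul h.dP)))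
    (((h.ta1.add (h.tb1.cm 2)).add (((h.ta.mul h.ta).add ((h.ta.mul h.tb).cm 2)).add
      ((h.tb.mul h.tb).cm 3))).sub ((h.tN.cm 4).sub h.tP)) _ hC
    (fun x t h0 hT hs hss hQ => ?_)⟩
  have := algR (a := a x t) (b := b x t) (a1 := a1 x t) (b1 := b1 x t) (a2 := a2 x t)
    (b2 := b2 x t) (a3 := a3 x t) (b3 := b3 x t) (N := N x t) (P := P x t)
    (by rw [← hs]; ring) (le_trans (le_of_eq (by ring)) hss)
  refine le_trans (le_of_eq ?_) this
  ring

end estimates2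

/-! ### Lower bound for the size of the fibre -/

theorem LB {T δ : ℝ} {X Xt : ℝ → ℝ → ℝ} (hδ : 0 < δ) (hT0 : 0 < T)
    (hc : ContinuousOn (fun p : ℝ × ℝ => X p.1 p.2) (Set.univ ×ˢ Set.Ico 0 T))
    (per : ∀ x t, X (x + 2 * π) t = X x t) (ht : Dt T X Xt)
    (pos : ∀ x t, 0 ≤ t → t < T → 0 < X x t)
    (hstep : ∀ x t, 0 < t → t < T → X x t ≤ δ → (∀ y, X x t ≤ X y t) → Xt x t < -(1 / 2)) :
    ∃ c, 0 < c ∧ ∀ x t, 0 ≤ t → t < T → c * (T - t) ≤ X x t := by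
  have hmain : ∀ x0 t0, 0 < t0 → t0 < T → X x0 t0 ≤ δ → (T - t0) / 2 ≤ X x0 t0 := by
    intro x0 t0 h0 hT hX
    by_contra hcon
    push Not at hcon
    set m0 := X x0 t0 with hm0
    have hm0p : 0 < m0 := pos x0 t0 h0.le hT
    set t1 := t0 + 2 * m0 with ht1
    have ht1T : t1 < T := by rw [ht1]; linarith
    set S : Set ℝ := {t | ∃ x ∈ Set.Icc (0 : ℝ) (2 * π), X x t ≤ m0 - (t - t0) / 2} with hS
    have hclosed : IsClosed (S ∩ Set.Icc t0 t1) := by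
      have e : S ∩ Set.Icc t0 t1 = Prod.snd '' ((Set.Icc (0 : ℝ) (2 * π) ×ˢ Set.Icc t0 t1) ∩
          (fun p : ℝ × ℝ => X p.1 p.2 - (m0 - (p.2 - t0) / 2)) ⁻¹' (Set.Iic 0)) := by
        ext t
        constructor
        · rintro ⟨⟨x, hx, hx2⟩, h⟩
          exact ⟨(x, t), ⟨⟨hx, h⟩, by simpa using hx2⟩, rfl⟩
        · rintro ⟨⟨x, t'⟩, ⟨⟨hx, h⟩, hx2⟩, rfl⟩
          exact ⟨⟨x, hx, by simpa using hx2⟩, h⟩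
      rw [e]
      refine (IsCompact.image ?_ continuous_snd).isClosed
      have hK : IsCompact (Set.Icc (0 : ℝ) (2 * π) ×ˢ Set.Icc t0 t1) :=
        isCompact_Icc.prod isCompact_Icc
      refine hK.of_isClosed_subset ?_ Set.inter_subset_left
      refine ContinuousOn.preimage_isClosed_of_isClosed ?_ hK.isClosed isClosed_Iic
      refine ContinuousOn.sub (hc.mono ?_) (by fun_prop)
      rintro ⟨x, t⟩ ⟨_, h⟩
      exact ⟨trivial, h0.le.trans h.1, h.2.trans_lt ht1T⟩
    have hsub : Set.Icc t0 t1 ⊆ S := by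
      refine hclosed.Icc_subset_of_forall_exists_gt ?_ ?_
      · obtain ⟨y, hy, h⟩ := per_red (q := fun x => X x t0) (fun x => per x t0) x0
        refine ⟨y, hy, ?_⟩
        have h' : m0 = X y t0 := h
        rw [← h']; simp
      · rintro t ⟨⟨x1, hx1, hx2⟩, h2, h3⟩ y hy
        have htp : 0 < t := h0.trans_le h2
        have htT : t < T := h3.trans ht1T
        have hcx : ContinuousOn (fun x => X x t) (Set.Icc 0 (2 * π)) :=
          hc.comp (f := fun x : ℝ => ((x, t) : ℝ × ℝ)) (by fun_prop)
            (fun x _ => ⟨trivial, htp.le, htT⟩)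
        obtain ⟨x, hx, hmin⟩ := isCompact_Icc.exists_isMinOn ⟨x1, hx1⟩ hcx
        have hmin' : ∀ y, X x t ≤ X y t := by
          intro y
          obtain ⟨z, hz, h⟩ := per_red (q := fun x => X x t) (fun x => per x t) y
          exact (hmin hz).trans (le_of_eq h.symm)
        have hxt : X x t ≤ m0 - (t - t0) / 2 := (hmin' x1).trans hx2
        have hd := hstep x t htp htT (by linarith) hmin'
        have hsl := (hasDerivAt_iff_tendsto_slope.mp (ht x t htp htT)).eventually (gt_mem_nhds hd)
        have hsl2 : ∀ᶠ τ in 𝓝[>] t, slope (fun τ => X x τ) t τ < -(1 / 2) :=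
          hsl.filter_mono (nhdsWithin_mono _ (fun x hx => ne_of_gt hx))
        obtain ⟨τ, hτ1, hτ2⟩ := (hsl2.and (Ioc_mem_nhdsGT hy)).exists
        refine ⟨τ, ⟨x, hx, ?_⟩, hτ2⟩
        have hpos : 0 < τ - t := sub_pos.mpr hτ2.1
        rw [slope_def_field, div_lt_iff₀ hpos] at hτ1
        linarith
    obtain ⟨x, _, hx⟩ := hsub (Set.right_mem_Icc.mpr (by rw [ht1]; linarith : t0 ≤ t1))
    have := pos x t1 (by rw [ht1]; linarith) ht1T
    rw [ht1] at hx this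
    linarith
  set c := min (1 / 2) (δ / T) with hcdef
  have hc0 : 0 < c := lt_min (by norm_num) (div_pos hδ hT0)
  have hpos' : ∀ x t, 0 < t → t < T → c * (T - t) ≤ X x t := by
    intro x t h0 hT
    by_cases hX : X x t ≤ δ
    · have h1 := hmain x t h0 hT hX
      have h2 : c * (T - t) ≤ 1 / 2 * (T - t) :=
        mul_le_mul_of_nonneg_right (min_le_left _ _) (by linarith)
      linarith
    · push Not at hX
      have h2 : c * (T - t) ≤ δ / T * T :=
        mul_le_mul (min_le_right _ _) (by linarith) (by linarith) (div_pos hδ hT0).le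
      rw [div_mul_cancel₀ _ hT0.ne'] at h2
      linarith
  refine ⟨c, hc0, fun x t h0 hT => ?_⟩
  rcases h0.eq_or_lt with rfl | h0
  · have hcl : (0 : ℝ) ∈ closure (Set.Ioo 0 T) := by
      rw [closure_Ioo hT0.ne]; exact ⟨le_refl _, hT0.le⟩
    have hX : ContinuousWithinAt (fun τ => X x τ) (Set.Ioo 0 T) 0 := by
      have h1 : ContinuousOn (fun τ => X x τ) (Set.Ico 0 T) :=
        hc.comp (f := fun τ : ℝ => ((x, τ) : ℝ × ℝ)) (by fun_prop) (fun τ h => ⟨trivial, h⟩)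
      exact (h1 0 ⟨le_refl _, hT0⟩).mono Set.Ioo_subset_Ico_self
    exact ContinuousWithinAt.closure_le (f := fun τ => c * (T - τ)) hcl
      (by fun_prop) hX (fun τ h => hpos' x τ h.1 h.2)
  · exact hpos' x t h0 hT

theorem algLB {a1 b b1 N P R0 H C6 i j f X : ℝ} (hi : 0 < i) (hj : 0 < j) (hf : 0 < f)
    (hfi : f * i = 1) (hX : X = f ^ 2) (hji : j ≤ i) (hN : N = j ^ 2) (hP : P * i ^ 2 = j ^ 4)
    (hR0 : 0 < R0) (hH : 0 ≤ H) (hC6 : 0 < C6) (h6 : i - j ≤ C6)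
    (hR : a1 + 2 * b1 + 3 * (b * b) - (4 * N - P) ≤ R0) (hh : |a1 - (b1 + b ^ 2)| ≤ H * j)
    (hfd : f ≤ 1 / (R0 + 2 * H + 28 * C6 + 1)) :
    2 * X * (a1 - 2 * P) < -(1 / 2) := by
  have hden : 0 < R0 + 2 * H + 28 * C6 + 1 := by positivity
  have hf1 : f * (R0 + 2 * H + 28 * C6 + 1) ≤ 1 := by rwa [le_div_iff₀ hden] at hfd
  obtain ⟨u, hu⟩ : ∃ u, u = f * j := ⟨_, rfl⟩
  have hu0 : 0 < u := by rw [hu]; positivity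
  have hu1 : u ≤ 1 := by
    have := mul_le_mul_of_nonneg_left hji hf.le
    linarith
  have hu6 : 1 - u ≤ C6 * f := by
    have := mul_le_mul_of_nonneg_left h6 hf.le
    linarith
  have hXN : X * N = u ^ 2 := by rw [hX, hN, hu]; ring
  have hXP : X * P = u ^ 4 := by
    rw [hX, hu]
    have : f ^ 2 * P = f ^ 4 * (P * i ^ 2) := by
      rw [show f ^ 4 * (P * i ^ 2) = f ^ 2 * P * (f * i) ^ 2 by ring, hfi]; ring
    rw [this, hP]; ring
  have hXj : X * j ≤ f := by
    have := mul_le_mul_of_nonneg_left hu1 hf.le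
    rw [hu] at this
    rw [hX]; linarith
  have hX0 : 0 < X := by rw [hX]; positivity
  have h3 : 3 * a1 ≤ R0 + 2 * (H * j) + 4 * N - P := by
    have := (abs_le.mp hh).2
    have hb := mul_self_nonneg b
    linarith
  have h4 := mul_le_mul_of_nonneg_left h3 hX0.le
  have hu4 := one_add_mul_le_pow (a := u - 1) (by linarith) 4
  rw [show 1 + (u - 1) = u by ring] at hu4
  push_cast at hu4
  have hu2 : u ^ 2 ≤ 1 := pow_le_one₀ hu0.le hu1
  have h5 := mul_le_mul_of_nonneg_left hXj (by positivity : 0 ≤ 2 * H)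
  have hff : f ≤ 1 := by
    have : 0 ≤ f * (R0 + 2 * H + 28 * C6) := by positivity
    linarith
  have h7 : X * R0 ≤ f * R0 := by
    rw [hX]
    have := mul_le_mul_of_nonneg_left hff (by positivity : 0 ≤ f * R0)
    linarith
  linarith

section concl

variable {T : ℝ} {ρ F G a b a1 b1 a2 b2 a3 b3 N P : ℝ → ℝ → ℝ}

theorem BFlow.final (h : BFlow T ρ F G a b a1 b1 a2 b2 a3 b3 N P) {x : ℝ} (hx : 0 < x)
    (hx2 : 4 / 3 < 2 * x ^ 5 + 4 * x ^ 4)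
    (hi1 : ∀ x, F x 0 ≤ G x 0) (hi2 : ∀ y, G y 0 + Real.log x ≤ F y 0)
    (hi4 : ∀ x, Real.exp (2 * F x 0) * (a x 0 * a x 0) ≤ 4 / 3) :
    ∃ H c : ℝ, 0 ≤ H ∧ 0 < c ∧ ∀ x t, 0 ≤ t → t < T → F x t ≤ G x t ∧
      Real.exp (G x t) * |(a1 x t + a x t ^ 2) - (b1 x t + b x t ^ 2)| ≤ H ∧
      c * (T - t) ≤ Real.exp (F x t) ^ 2 := by
  have h1 := h.E1 hi1
  have h2 := h.E2 h1 hi2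
  obtain ⟨C3, h3⟩ := h.E3 h1
  have h4 := h.E4 h1 hi4
  obtain ⟨C5, hC5, h5⟩ := h.E5 h1
  have h2' : ∀ y t, 0 ≤ t → t < T → x * Real.exp (-1 * F y t) ≤ Real.exp (-1 * G y t) := by
    intro y t h0 hT
    nth_rw 1 [← Real.exp_log hx]
    rw [← Real.exp_add, Real.exp_le_exp]
    linarith [h2 y t h0 hT]
  obtain ⟨C6, hC6, h6⟩ := h.E6 h1 hx hx2 h2' h4
  have hji : ∀ y t, 0 ≤ t → t < T → Real.exp (-1 * G y t) ≤ Real.exp (-1 * F y t) := by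
    intro y t h0 hT
    rw [Real.exp_le_exp]; linarith [h1 y t h0 hT]
  have hnp := fun y t h0 hT => algNP (Real.exp_pos (-1 * F y t)) (Real.exp_pos (-1 * G y t))
    (hji y t h0 hT) hx (h2' y t h0 hT) (h.ij y t).1 (h.ij y t).2.1 hC6 (h6 y t h0 hT)
    (h.bb (h5 y t h0 hT)).2 (Real.sqrt_nonneg C5)
  obtain ⟨D, hD, h7⟩ := h.E7 (D := 2 * C6 * √C5 / x) (by positivity)
    (fun y t h0 hT => (hnp y t h0 hT).2.2)
  obtain ⟨W, hW, h8⟩ := h.E8 (V := 2 * C6) h1 h3 hC5 h5 hD h7 (by positivity)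
    (fun y t h0 hT => by rw [abs_of_nonneg (hnp y t h0 hT).1]; exact (hnp y t h0 hT).2.1)
  obtain ⟨R0, hR0, hR⟩ := h.ER
  obtain ⟨H, hH⟩ : ∃ H, H = W + D * D * Real.exp C3 + 2 * D * √C5 := ⟨_, rfl⟩
  have hH0 : 0 ≤ H := by
    rw [hH]
    have := Real.exp_pos C3
    positivity
  have gj : ∀ y t, Real.exp (G y t) * Real.exp (-1 * G y t) = 1 := by
    intro y t
    rw [← Real.exp_add, Real.exp_eq_one_iff]; ring
  have fi : ∀ y t, Real.exp (F y t) * Real.exp (-1 * F y t) = 1 := by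
    intro y t
    rw [← Real.exp_add, Real.exp_eq_one_iff]; ring
  have hh : ∀ y t, 0 ≤ t → t < T →
      Real.exp (G y t) * |(a1 y t + a y t ^ 2) - (b1 y t + b y t ^ 2)| ≤ H := by
    intro y t h0 hT
    have hg := Real.exp_pos (G y t)
    have hgM : Real.exp (G y t) ≤ Real.exp C3 := Real.exp_le_exp.mpr (h3 y t h0 hT)
    have hb := (h.bb (h5 y t h0 hT)).2
    have hy := h7 y t h0 hT
    have e : (a1 y t + a y t ^ 2) - (b1 y t + b y t ^ 2) = (a1 y t - b1 y t)
        + ((a y t - b y t) * (a y t - b y t) + 2 * ((a y t - b y t) * b y t)) := by ring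
    have k1 := abs_prod2 hy hy
    have k2 := abs_prod2 hy hb
    have k3 : |2 * ((a y t - b y t) * b y t)| ≤ 2 * (D * (√C5 * Real.exp (-1 * G y t))) := by
      rw [abs_mul, abs_of_pos (by norm_num : (0 : ℝ) < 2)]
      linarith
    have k4 : |(a1 y t + a y t ^ 2) - (b1 y t + b y t ^ 2)| ≤ |a1 y t - b1 y t|
        + (D * D + 2 * (D * (√C5 * Real.exp (-1 * G y t)))) := by
      rw [e]
      refine (abs_add_le _ _).trans ?_
      have := abs_add_le ((a y t - b y t) * (a y t - b y t)) (2 * ((a y t - b y t) * b y t))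
      linarith
    have k5 := mul_le_mul_of_nonneg_left k4 hg.le
    have k6 := mul_le_mul_of_nonneg_left hgM (by positivity : 0 ≤ D * D)
    have k7 := h8 y t h0 hT
    rw [hH]
    linear_combination k5 + k6 + k7 + 2 * D * √C5 * gj y t
  have hhj : ∀ y t, 0 ≤ t → t < T →
      |(a1 y t + a y t ^ 2) - (b1 y t + b y t ^ 2)| ≤ H * Real.exp (-1 * G y t) := by
    intro y t h0 hT
    have := mul_le_mul_of_nonneg_right (hh y t h0 hT) (Real.exp_pos (-1 * G y t)).le
    linear_combination this - |(a1 y t + a y t ^ 2) - (b1 y t + b y t ^ 2)| * gj y t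
  have eX : ∀ y t, Real.exp (2 * F y t) = Real.exp (F y t) ^ 2 := by
    intro y t
    rw [← Real.exp_nat_mul]; norm_num
  have hden : 0 < R0 + 2 * H + 28 * C6 + 1 := by positivity
  obtain ⟨c, hc0, hc⟩ := LB (X := fun x t => Real.exp (2 * F x t))
    (δ := (1 / (R0 + 2 * H + 28 * C6 + 1)) ^ 2) (by positivity) h.Tpos
    (Real.continuous_exp.comp_continuousOn (continuousOn_const.mul h.sF.cont))
    (fun x t => by rw [h.pF]) (h.tF.ex 2) (fun x t _ _ => Real.exp_pos _)
    (fun y t h0 hT hX hmin => by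
      have hd := h.dF.ex 2 y t h0.le hT
      have hz := IsLocalMin.hasDerivAt_eq_zero (Filter.Eventually.of_forall hmin) hd
      have ha : a y t = 0 := by
        have hr := (h.rpos y t h0.le hT).ne'
        have he := (Real.exp_pos (2 * F y t)).ne'
        have hz' : ρ y t * (2 * a y t * Real.exp (2 * F y t)) = 0 := hz
        simpa [hr, he] using hz'
      have hf := Real.exp_pos (F y t)
      have hfd : Real.exp (F y t) ≤ 1 / (R0 + 2 * H + 28 * C6 + 1) := by
        have hX' : Real.exp (2 * F y t) ≤ (1 / (R0 + 2 * H + 28 * C6 + 1)) ^ 2 := hX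
        rw [eX] at hX'
        exact le_of_sq_le_sq hX' (by positivity)
      have hR1 := hR y t h0.le hT
      have hh1 := hhj y t h0.le hT
      rw [ha] at hR1 hh1
      have := algLB (a1 := a1 y t) (b := b y t) (b1 := b1 y t) (H := H)
        (Real.exp_pos (-1 * F y t)) (Real.exp_pos (-1 * G y t)) hf (fi y t) (eX y t)
        (hji y t h0.le hT) (h.ij y t).1 (h.ij y t).2.1 hR0 hH0 hC6 (h6 y t h0.le hT)
        (by linarith) (by simpa using hh1) hfd
      refine lt_of_eq_of_lt ?_ this
      rw [ha]; ring)
  refine ⟨H, c, hH0, hc0, fun y t h0 hT => ⟨h1 y t h0 hT, hh y t h0 hT, ?_⟩⟩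
  rw [← eX]
  exact hc y t h0 hT

end concl

theorem pinch_aux {T : ℝ} {f g ρ : ℝ → ℝ → ℝ} (sol : AssumptionB T f g ρ) :
    ∃ H c : ℝ, 0 ≤ H ∧ 0 < c ∧ ∀ x t, 0 ≤ t → t < T → f x t ≤ g x t ∧
      g x t * |k01 ρ f x t - k02 ρ g x t| ≤ H ∧ c * (T - t) ≤ f x t ^ 2 := by
  have solA := sol.toAssumptionA
  have solW := solA.toWarpedBerger
  obtain ⟨F, G, a, b, a1, b1, a2, b2, a3, b3, N, P, h, hk⟩ := flow_of solW
  obtain ⟨ε, he0, he1, he2, he3⟩ := sol.init_pinched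
  have hT := solW.T_pos
  have hx : 0 < 1 - ε := by linarith
  obtain ⟨H, c, hH, hc, hfin⟩ := h.final hx he2
    (fun x => by
      obtain ⟨k1, k2, -⟩ := hk x 0 le_rfl hT
      have := solA.init_order x
      rwa [k1, k2, Real.exp_le_exp] at this)
    (fun x => by
      obtain ⟨k1, k2, -⟩ := hk x 0 le_rfl hT
      have := he3 x
      rw [k1, k2] at this
      nth_rw 1 [← Real.exp_log hx] at this
      rw [← Real.exp_add, Real.exp_le_exp] at this
      linarith)
    (fun x => by
      obtain ⟨k1, k2, k3, -⟩ := hk x 0 le_rfl hT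
      have := sol.init_fs x
      rw [k3, k1] at this
      have h2 : (Real.exp (F x 0) * a x 0) ^ 2 ≤ 1 := by
        rw [← sq_abs]; exact pow_le_one₀ (abs_nonneg _) this
      have eX : Real.exp (2 * F x 0) = Real.exp (F x 0) ^ 2 := by
        rw [← Real.exp_nat_mul]; norm_num
      rw [eX]
      linarith)
  refine ⟨H, c, hH, hc, fun x t h0 hT => ?_⟩
  obtain ⟨k1, k2, k3, k4, k5⟩ := hk x t h0 hT
  obtain ⟨m1, m2, m3⟩ := hfin x t h0 hT
  rw [k4, k5, k1, k2]
  refine ⟨Real.exp_le_exp.mpr m1, ?_, m3⟩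
  rwa [show -(a1 x t + a x t ^ 2) - -(b1 x t + b x t ^ 2)
    = -((a1 x t + a x t ^ 2) - (b1 x t + b x t ^ 2)) by ring, abs_neg]

/-- Under Assumption B there is a uniform constant `C` such that
`|κ₀₁ − κ₀₂| ≤ C/M̌(t)`, and consequently `(T−t)|κ₀₁ − κ₀₂| ≤ C√(T−t)`. -/
theorem mixed_curvature_pinching (T : ℝ) (f g ρ : ℝ → ℝ → ℝ)
    (sol : AssumptionB T f g ρ) :
    ∃ C : ℝ, ∀ ξ t : ℝ, 0 ≤ t → t < T →
      |k01 ρ f ξ t - k02 ρ g ξ t| ≤ C / Mcheck f g t ∧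
      (T - t) * |k01 ρ f ξ t - k02 ρ g ξ t| ≤ C * Real.sqrt (T - t) := by
  obtain ⟨H, c, hH, hc, hk⟩ := pinch_aux sol
  have fp := sol.toAssumptionA.toWarpedBerger.f_pos
  refine ⟨max H (H / √c), fun x t h0 hT => ?_⟩
  have hTt : 0 < T - t := by linarith
  obtain ⟨k1, k2, k3⟩ := hk x t h0 hT
  have hlow : ∀ y, √(c * (T - t)) ≤ M f g y t := by
    intro y
    obtain ⟨l1, l2, l3⟩ := hk y t h0 hT
    have : √(c * (T - t)) ≤ f y t := by
      rw [← Real.sqrt_sq (fp y t h0 hT).le]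
      exact Real.sqrt_le_sqrt l3
    exact le_min this (this.trans l1)
  have hs : 0 < √(c * (T - t)) := Real.sqrt_pos.mpr (by positivity)
  have hM : √(c * (T - t)) ≤ Mcheck f g t := le_ciInf hlow
  have hMpos : 0 < Mcheck f g t := hs.trans_le hM
  have hMle : Mcheck f g t ≤ g x t := by
    refine (ciInf_le ⟨√(c * (T - t)), ?_⟩ x).trans (min_le_right _ _)
    rintro _ ⟨y, rfl⟩
    exact hlow y
  have hm : |k01 ρ f x t - k02 ρ g x t| * Mcheck f g t ≤ H := by
    have := mul_le_mul_of_nonneg_left hMle (abs_nonneg (k01 ρ f x t - k02 ρ g x t))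
    linarith
  refine ⟨?_, ?_⟩
  · rw [le_div_iff₀ hMpos]
    exact hm.trans (le_max_left _ _)
  · have h3 : |k01 ρ f x t - k02 ρ g x t| * √(c * (T - t)) ≤ H :=
      (mul_le_mul_of_nonneg_left hM (abs_nonneg _)).trans hm
    rw [Real.sqrt_mul hc.le] at h3
    have hsc : 0 < √c := Real.sqrt_pos.mpr hc
    have h4 : |k01 ρ f x t - k02 ρ g x t| * √(T - t) ≤ H / √c := by
      rw [le_div_iff₀ hsc]; linarith
    have h5 := mul_le_mul_of_nonneg_right (h4.trans (le_max_right H (H / √c)))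
      (Real.sqrt_nonneg (T - t))
    rw [mul_assoc, Real.mul_self_sqrt hTt.le] at h5
    linarith
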